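/- arXiv:1604.07870 — 6 statements merged into one kernel-verified Lean document; each statement's English description precedes it below -/
import Mathlib

section
/- Fix ε>0 and p>0. There exists a constant C>0 (depending only on ε and p) such that for every f ∈ W^{1,2}(D₀) ∩ L¹(D₀) and every g ∈ W^{1,2}((0,∞)) ∩ L¹((0,∞)), setting E := (1/2)∫_{D₀}|∇f(x)|² dx + (p/2)∫₀^∞ g'(x)² dx, N₁ := ∫_{D₀}|f(x)| dx + p∫₀^∞ |g(x)| dx, and N₂² := ∫_{D₀} f(x)² dx + p∫₀^∞ g(x)² dx, one has N₂² ≤ C ( E^{1/2} N₁ + E^{1/3} N₁^{4/3} ). (This is the Nash-type inequality for the Dirichlet form of Brownian motion with varying dimension, written componentwise on the plane part and the pole part.) -/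
open MeasureTheory Set Real

/-- `D₀ = ℝ² \ B̄(0,ε)`, the complement of the closed disk of radius `ε` centered at the
origin in the plane. -/
def D₀ (ε : ℝ) : Set (EuclideanSpace ℝ (Fin 2)) := (Metric.closedBall 0 ε)ᶜ

/-- `F` is a weak (distributional) gradient of `f` on the open set `U ⊆ ℝ²`:
integration by parts against smooth test functions compactly supported in `U`. -/
def IsWeakGradientOn (f : EuclideanSpace ℝ (Fin 2) → ℝ)
    (F : EuclideanSpace ℝ (Fin 2) → EuclideanSpace ℝ (Fin 2))
    (U : Set (EuclideanSpace ℝ (Fin 2))) : Prop :=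
  ∀ φ : EuclideanSpace ℝ (Fin 2) → ℝ, ContDiff ℝ (⊤ : ℕ∞) φ → HasCompactSupport φ →
    tsupport φ ⊆ U →
    ∫ x in U, f x • gradient φ x = - ∫ x in U, φ x • F x

/-- `g'` is a weak (distributional) derivative of `g` on the half-line `(0,∞)`. -/
def IsWeakDerivOnHalfLine (g g' : ℝ → ℝ) : Prop :=
  ∀ φ : ℝ → ℝ, ContDiff ℝ (⊤ : ℕ∞) φ → HasCompactSupport φ → tsupport φ ⊆ Set.Ioi (0 : ℝ) →
    ∫ x in Set.Ioi (0 : ℝ), g x * deriv φ x = - ∫ x in Set.Ioi (0 : ℝ), φ x * g' x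

section NashOnCone

open scoped Pointwise

variable {E : Type*} [NormedAddCommGroup E] [NormedSpace ℝ E] [FiniteDimensional ℝ E]
  [MeasurableSpace E] [BorelSpace E] {μ : Measure E}

/-- Smooth functions with compact support contained in `U`. -/
def IsTestOn (U : Set E) (φ : E → ℝ) : Prop :=
  ContDiff ℝ (⊤ : ℕ∞) φ ∧ HasCompactSupport φ ∧ tsupport φ ⊆ U

/-- The distributional gradient of `f` on `U` has `L²` norm at most `M`, expressed by duality. -/
def WeakGradLE (μ : Measure E) (U : Set E) (f : E → ℝ) (M : ℝ) : Prop :=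
  ∀ φ : E → ℝ, IsTestOn U φ → ∀ h : E,
    |∫ x, f x * fderiv ℝ φ x h ∂μ| ≤ ‖h‖ * M * √(∫ x, φ x ^ 2 ∂μ)

omit [FiniteDimensional ℝ E] [MeasurableSpace E] [BorelSpace E] in
theorem IsTestOn.translate {U : Set E} {φ : E → ℝ} (hφ : IsTestOn U φ) {h : E}
    (hU : ∀ x ∈ U, x + h ∈ U) : IsTestOn U (fun x => φ (x - h)) := by
  obtain ⟨h1, h2, h3⟩ := hφ
  refine ⟨h1.comp (contDiff_id.sub contDiff_const), ?_, ?_⟩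
  · exact h2.comp_homeomorph (Homeomorph.subRight h)
  · have : tsupport (fun x => φ (x - h)) = (Homeomorph.subRight h) ⁻¹' tsupport φ :=
      tsupport_comp_eq_preimage φ (Homeomorph.subRight h)
    rw [this]
    intro x hx
    have := hU _ (h3 hx)
    simpa using this

omit [FiniteDimensional ℝ E] in
theorem IsTestOn.memLp {U : Set E} {φ : E → ℝ} (hφ : IsTestOn U φ) [IsFiniteMeasureOnCompacts μ]
    (p : ENNReal) : MemLp φ p μ :=
  hφ.1.continuous.memLp_of_hasCompactSupport hφ.2.1

omit [FiniteDimensional ℝ E] in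
/-- Translations of a function with bounded weak gradient, tested against smooth functions. -/
theorem WeakGradLE.abs_integral_translate_sub_mul_le [μ.IsAddHaarMeasure] {U : Set E} {f : E → ℝ}
    {M : ℝ} (hf : WeakGradLE μ U f M) (hfi : Integrable f μ) {φ : E → ℝ} (hφ : IsTestOn U φ)
    {h : E} (hU : ∀ t : ℝ, 0 ≤ t → ∀ x ∈ U, x + t • h ∈ U) :
    |∫ x, (f (x + h) - f x) * φ x ∂μ| ≤ ‖h‖ * M * √(∫ x, φ x ^ 2 ∂μ) := by
  have hφd : Differentiable ℝ φ := hφ.1.differentiable (by simp)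
  have hφ'c : Continuous (fderiv ℝ φ) := hφ.1.continuous_fderiv (by simp)
  obtain ⟨C, hC⟩ := hφ'c.bounded_above_of_compact_support (hφ.2.1.fderiv ℝ)
  obtain ⟨C₀, hC₀⟩ := hφ.1.continuous.bounded_above_of_compact_support hφ.2.1
  have hder : ∀ t : ℝ, HasDerivAt (fun t : ℝ => ∫ x, f x * φ (x - t • h) ∂μ)
      (∫ x, f x * (-(fderiv ℝ φ (x - t • h) h)) ∂μ) t := by
    intro t
    refine (hasDerivAt_integral_of_dominated_loc_of_deriv_le
      (F := fun (t : ℝ) x => f x * φ (x - t • h))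
      (F' := fun (t : ℝ) x => f x * (-(fderiv ℝ φ (x - t • h) h)))
      (bound := fun x => ‖f x‖ * (C * ‖h‖)) Filter.univ_mem ?_ ?_ ?_ ?_ ?_ ?_).2
    · refine Filter.Eventually.of_forall fun t => ?_
      exact hfi.aestronglyMeasurable.mul
        (hφ.1.continuous.comp (by fun_prop)).aestronglyMeasurable
    · exact hfi.mul_bdd (c := C₀) (hφ.1.continuous.comp (by fun_prop)).aestronglyMeasurable
        (Filter.Eventually.of_forall fun x => hC₀ _)
    · refine hfi.aestronglyMeasurable.mul (Continuous.aestronglyMeasurable ?_)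
      have : Continuous fun x : E => fderiv ℝ φ (x - t • h) := hφ'c.comp (by fun_prop)
      fun_prop
    · refine Filter.Eventually.of_forall fun x t _ => ?_
      rw [norm_mul, norm_neg]
      gcongr
      exact ((fderiv ℝ φ _).le_opNorm h).trans (by gcongr; exact hC _)
    · exact hfi.norm.mul_const _
    · refine Filter.Eventually.of_forall fun x t _ => ?_
      have h1 : HasDerivAt (fun t : ℝ => x - t • h) (-h) t := by
        simpa using ((hasDerivAt_id t).smul_const h).const_sub x
      have h2 := (hφd (x - t • h)).hasFDerivAt.comp_hasDerivAt t h1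
      simpa using h2.const_mul (f x)
  have key := norm_image_sub_le_of_norm_deriv_le_segment_01'
    (f := fun t : ℝ => ∫ x, f x * φ (x - t • h) ∂μ) (C := ‖h‖ * M * √(∫ x, φ x ^ 2 ∂μ))
    (fun t _ => (hder t).hasDerivWithinAt) (by
      intro t ht
      have hT := hφ.translate (hU t ht.1)
      have := hf _ hT h
      have e1 : ∀ x, fderiv ℝ (fun x => φ (x - t • h)) x = fderiv ℝ φ (x - t • h) :=
        fun x => by
          simpa only [sub_eq_add_neg] using fderiv_comp_add_right (f := φ) (x := x) (-(t • h))
      have e2 : ∫ x, φ (x - t • h) ^ 2 ∂μ = ∫ x, φ x ^ 2 ∂μ :=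
        integral_sub_right_eq_self (fun x => φ x ^ 2) _
      simp only [e1] at this
      rw [e2] at this
      simpa [integral_neg] using this)
  have e3 : ∫ x, f x * φ (x - h) ∂μ = ∫ x, f (x + h) * φ x ∂μ := by
    rw [← integral_add_right_eq_self (fun x => f x * φ (x - h)) h]
    simp
  simp only [one_smul, zero_smul, sub_zero, Real.norm_eq_abs] at key
  rw [e3, ← integral_sub] at key
  · simpa only [sub_mul] using key
  · exact (hfi.comp_add_right h).mul_bdd (c := C₀) hφ.1.continuous.aestronglyMeasurable
      (Filter.Eventually.of_forall fun x => hC₀ _)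
  · exact hfi.mul_bdd (c := C₀) hφ.1.continuous.aestronglyMeasurable
      (Filter.Eventually.of_forall fun x => hC₀ _)

theorem norm_toLp_two_eq_sqrt {X : Type*} [MeasurableSpace X] {ν : Measure X} {u : X → ℝ}
    (hu : MemLp u 2 ν) :
    ‖hu.toLp u‖ = √(∫ x, u x ^ 2 ∂ν) := by
  rw [norm_eq_sqrt_real_inner, L2.inner_def]
  congr 1
  refine integral_congr_ae ?_
  filter_upwards [hu.coeFn_toLp] with x hx
  simp [hx, sq]

theorem inner_toLp_two_eq {X : Type*} [MeasurableSpace X] {ν : Measure X} {u v : X → ℝ}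
    (hu : MemLp u 2 ν) (hv : MemLp v 2 ν) :
    inner ℝ (hu.toLp u) (hv.toLp v) = ∫ x, u x * v x ∂ν := by
  rw [L2.inner_def]
  refine integral_congr_ae ?_
  filter_upwards [hu.coeFn_toLp, hv.coeFn_toLp] with x hx hy
  simp [hx, hy, mul_comm]

/-- Test functions on an open set `U` are dense in `L²(U)`. -/
theorem dense_isTestOn [IsFiniteMeasureOnCompacts μ] {U : Set E} (hU : IsOpen U) :
    Dense {u : Lp ℝ 2 (μ.restrict U) |
      ∃ φ, ∃ hφ : IsTestOn U φ, u = (hφ.memLp (μ := μ.restrict U) 2).toLp φ} := by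
  let V : Submodule ℝ (Lp ℝ 2 (μ.restrict U)) :=
    { carrier := {u | ∃ φ, ∃ hφ : IsTestOn U φ, u = (hφ.memLp (μ := μ.restrict U) 2).toLp φ}
      add_mem' := by
        rintro _ _ ⟨φ, hφ, rfl⟩ ⟨ψ, hψ, rfl⟩
        refine ⟨φ + ψ, ⟨hφ.1.add hψ.1, hφ.2.1.add hψ.2.1, ?_⟩, ?_⟩
        · exact (tsupport_add φ ψ).trans (union_subset hφ.2.2 hψ.2.2)
        · exact (MemLp.toLp_add _ _).symm
      zero_mem' := by
        refine ⟨0, ⟨contDiff_const, HasCompactSupport.zero, by simp [tsupport]⟩, ?_⟩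
        exact (MemLp.toLp_zero _).symm
      smul_mem' := by
        rintro c _ ⟨φ, hφ, rfl⟩
        refine ⟨c • φ, ⟨hφ.1.const_smul c, hφ.2.1.smul_left (f := fun _ => c), ?_⟩, ?_⟩
        · exact (tsupport_smul_subset_right (fun _ => c) φ).trans hφ.2.2
        · exact (MemLp.toLp_const_smul _ _).symm }
  change Dense (V : Set (Lp ℝ 2 (μ.restrict U)))
  rw [Submodule.dense_iff_topologicalClosure_eq_top, Submodule.topologicalClosure_eq_top_iff,
    Submodule.eq_bot_iff]
  intro v hv
  have hv2 : MemLp v 2 (μ.restrict U) := Lp.memLp v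
  have hloc : LocallyIntegrableOn v U μ :=
    locallyIntegrableOn_of_locallyIntegrable_restrict (hv2.locallyIntegrable (by norm_num))
  have hae : ∀ᵐ x ∂μ, x ∈ U → v x = 0 := by
    refine hU.ae_eq_zero_of_integral_contDiff_smul_eq_zero hloc fun φ h1 h2 h3 => ?_
    have hφ : IsTestOn U φ := ⟨h1, h2, h3⟩
    have h0 := (Submodule.mem_orthogonal V v).1 hv _ ⟨φ, hφ, rfl⟩
    have h0' : ∫ x in U, φ x * v x ∂μ = 0 := by
      have := inner_toLp_two_eq (hφ.memLp (μ := μ.restrict U) 2) hv2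
      rwa [Lp.toLp_coeFn, h0, eq_comm] at this
    rw [← h0']
    refine (setIntegral_eq_integral_of_forall_compl_eq_zero fun x hx => ?_).symm
    rw [image_eq_zero_of_notMem_tsupport fun hx' => hx (h3 hx'), zero_smul]
  refine (Lp.eq_zero_iff_ae_eq_zero).2 ?_
  exact (ae_restrict_iff' hU.measurableSet).2 hae

/-- A bound on the pairing of `v ∈ L²` with test functions on `U` extends to all of `L²(U)`. -/
theorem abs_integral_mul_le_of_forall_isTestOn [IsFiniteMeasureOnCompacts μ] {U : Set E}
    (hU : IsOpen U) {v : E → ℝ} (hv : MemLp v 2 μ) {c : ℝ}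
    (H : ∀ φ, IsTestOn U φ → |∫ x, v x * φ x ∂μ| ≤ c * √(∫ x, φ x ^ 2 ∂μ))
    {u : E → ℝ} (hu : MemLp u 2 μ) (hu0 : ∀ x, x ∉ U → u x = 0) :
    |∫ x, v x * u x ∂μ| ≤ c * √(∫ x, u x ^ 2 ∂μ) := by
  have hv' := hv.restrict U
  have hu' := hu.restrict U
  have e1 : ∀ w : E → ℝ, (∀ x, x ∉ U → w x = 0) →
      ∫ x in U, v x * w x ∂μ = ∫ x, v x * w x ∂μ := fun w hw =>
    setIntegral_eq_integral_of_forall_compl_eq_zero fun x hx => by simp [hw x hx]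
  have e2 : ∀ w : E → ℝ, (∀ x, x ∉ U → w x = 0) →
      ∫ x in U, w x ^ 2 ∂μ = ∫ x, w x ^ 2 ∂μ := fun w hw =>
    setIntegral_eq_integral_of_forall_compl_eq_zero fun x hx => by simp [hw x hx]
  have main : ∀ w : Lp ℝ 2 (μ.restrict U), |inner ℝ (hv'.toLp v) w| ≤ c * ‖w‖ := by
    intro w
    refine (dense_isTestOn (μ := μ) hU).induction
      (P := fun w => |inner ℝ (hv'.toLp v) w| ≤ c * ‖w‖) ?_ ?_ w
    · rintro _ ⟨φ, hφ, rfl⟩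
      have h0 : ∀ x, x ∉ U → φ x = 0 := fun x hx =>
        image_eq_zero_of_notMem_tsupport fun hx' => hx (hφ.2.2 hx')
      rw [inner_toLp_two_eq, norm_toLp_two_eq_sqrt, e1 φ h0, e2 φ h0]
      exact H φ hφ
    · exact isClosed_le (by fun_prop) (by fun_prop)
  have := main (hu'.toLp u)
  rwa [inner_toLp_two_eq, norm_toLp_two_eq_sqrt, e1 u hu0, e2 u hu0] at this

theorem WeakGradLE.integral_sq_le_add_integral_translate [μ.IsAddHaarMeasure] {U : Set E}
    (hUo : IsOpen U) {f : E → ℝ} {M : ℝ} (hf : WeakGradLE μ U f M) (hf1 : Integrable f μ)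
    (hf2 : MemLp f 2 μ) (hf0 : ∀ x, x ∉ U → f x = 0) {h : E}
    (hU : ∀ t : ℝ, 0 ≤ t → ∀ x ∈ U, x + t • h ∈ U) :
    ∫ x, f x ^ 2 ∂μ ≤ ‖h‖ * M * √(∫ x, f x ^ 2 ∂μ) + ∫ x, f x * f (x + h) ∂μ := by
  have hfh : MemLp (fun x => f (x + h)) 2 μ :=
    hf2.comp_measurePreserving (measurePreserving_add_right μ h)
  have key := abs_integral_mul_le_of_forall_isTestOn hUo (hfh.sub hf2)
    (fun φ hφ => hf.abs_integral_translate_sub_mul_le hf1 hφ hU) hf2 hf0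
  have e : ∫ x, ((fun x => f (x + h)) - f) x * f x ∂μ
      = ∫ x, f x * f (x + h) ∂μ - ∫ x, f x ^ 2 ∂μ := by
    have hi : Integrable (fun x => f x * f (x + h)) μ := MemLp.integrable_mul hf2 hfh
    rw [← integral_sub hi hf2.integrable_sq]
    refine integral_congr_ae (Filter.Eventually.of_forall fun x => ?_)
    simp only [Pi.sub_apply]
    ring
  rw [e] at key
  linarith [(abs_le.1 key).1]

/-- Averaging the translation estimate over a dilated cone of directions. -/
theorem WeakGradLE.integral_sq_le_of_cone [μ.IsAddHaarMeasure] {U K : Set E}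
    (hUo : IsOpen U) {f : E → ℝ} {M : ℝ} (hM : 0 ≤ M) (hf : WeakGradLE μ U f M)
    (hfm : Measurable f) (hf1 : Integrable f μ)
    (hf2 : MemLp f 2 μ) (hf0 : ∀ x, x ∉ U → f x = 0)
    (hKm : MeasurableSet K) (hK0 : μ K ≠ 0) (hKb : ∀ h ∈ K, ‖h‖ ≤ 1)
    (hU : ∀ h ∈ K, ∀ t : ℝ, 0 ≤ t → ∀ x ∈ U, x + t • h ∈ U) {δ : ℝ} (hδ : 0 < δ) :
    ∫ x, f x ^ 2 ∂μ ≤ δ * M * √(∫ x, f x ^ 2 ∂μ)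
      + (μ.real K)⁻¹ * (δ ^ Module.finrank ℝ E)⁻¹ * (∫ x, |f x| ∂μ) ^ 2 := by
  have hKt : μ K ≠ ⊤ := by
    refine ((measure_mono fun h hh => ?_).trans_lt
      (measure_closedBall_lt_top (x := (0 : E)) (r := 1) (μ := μ))).ne
    simpa using hKb h hh
  set A := ∫ x, f x ^ 2 ∂μ - δ * M * √(∫ x, f x ^ 2 ∂μ) with hA
  have hpt : ∀ h ∈ δ • K, ENNReal.ofReal A ≤ ∫⁻ x, ‖f x‖ₑ * ‖f (x + h)‖ₑ ∂μ := by
    rintro _ ⟨k, hk, rfl⟩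
    have h1 := hf.integral_sq_le_add_integral_translate hUo hf1 hf2 hf0 (h := δ • k)
      (fun t ht x hx => by
        rw [smul_smul]; exact hU k hk _ (by positivity) x hx)
    have hn : ‖δ • k‖ ≤ δ := by
      rw [norm_smul, Real.norm_of_nonneg hδ.le]
      exact mul_le_of_le_one_right hδ.le (hKb k hk)
    have h2 : A ≤ ∫ x, f x * f (x + δ • k) ∂μ := by
      have : ‖δ • k‖ * M * √(∫ x, f x ^ 2 ∂μ) ≤ δ * M * √(∫ x, f x ^ 2 ∂μ) := by gcongr
      linarith
    calc ENNReal.ofReal A ≤ ENNReal.ofReal ‖∫ x, f x * f (x + δ • k) ∂μ‖ :=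
          ENNReal.ofReal_le_ofReal (h2.trans (le_abs_self _))
      _ = ‖∫ x, f x * f (x + δ • k) ∂μ‖ₑ := ofReal_norm _
      _ ≤ ∫⁻ x, ‖f x * f (x + δ • k)‖ₑ ∂μ := enorm_integral_le_lintegral_enorm _
      _ = _ := by simp only [enorm_mul]
  have hbound : ENNReal.ofReal A * μ (δ • K) ≤ (∫⁻ x, ‖f x‖ₑ ∂μ) ^ 2 := by
    calc ENNReal.ofReal A * μ (δ • K) = ∫⁻ _ in δ • K, ENNReal.ofReal A ∂μ := by simp
      _ ≤ ∫⁻ h in δ • K, ∫⁻ x, ‖f x‖ₑ * ‖f (x + h)‖ₑ ∂μ ∂μ :=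
          setLIntegral_mono' (hKm.const_smul₀ δ) hpt
      _ ≤ ∫⁻ h, ∫⁻ x, ‖f x‖ₑ * ‖f (x + h)‖ₑ ∂μ ∂μ := setLIntegral_le_lintegral _ _
      _ = ∫⁻ x, ∫⁻ h, ‖f x‖ₑ * ‖f (x + h)‖ₑ ∂μ ∂μ := by
          refine lintegral_lintegral_swap (Measurable.aemeasurable ?_)
          unfold Function.uncurry
          fun_prop
      _ = ∫⁻ x, ‖f x‖ₑ * ∫⁻ y, ‖f y‖ₑ ∂μ ∂μ := by
          refine lintegral_congr fun x => ?_
          rw [lintegral_const_mul _ (by fun_prop), lintegral_add_left_eq_self (fun y => ‖f y‖ₑ) x]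
      _ = _ := by rw [lintegral_mul_const _ (by fun_prop), sq]
  rw [Measure.addHaar_smul, abs_of_pos (by positivity),
    ← MeasureTheory.ofReal_integral_norm_eq_lintegral_enorm hf1] at hbound
  have hreal : A * (δ ^ Module.finrank ℝ E * μ.real K) ≤ (∫ x, |f x| ∂μ) ^ 2 := by
    have hnn : 0 ≤ ∫ x, |f x| ∂μ := integral_nonneg fun x => abs_nonneg _
    simp only [Real.norm_eq_abs] at hbound
    rw [← ENNReal.ofReal_toReal hKt, ← ENNReal.ofReal_mul (by positivity),
      ← ENNReal.ofReal_mul' (by positivity), ← ENNReal.ofReal_pow hnn] at hbound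
    exact (ENNReal.ofReal_le_ofReal_iff (by positivity)).1 hbound
  have hKr : 0 < μ.real K := ENNReal.toReal_pos hK0 hKt
  have : A ≤ (∫ x, |f x| ∂μ) ^ 2 / (δ ^ Module.finrank ℝ E * μ.real K) :=
    (le_div_iff₀ (by positivity)).2 hreal
  rw [div_eq_mul_inv, mul_inv, mul_comm] at this
  linarith

/-- The averaged translation estimate for functions given on `U` only. -/
theorem setIntegral_sq_le_of_cone [μ.IsAddHaarMeasure] {U K : Set E}
    (hUo : IsOpen U) (hKm : MeasurableSet K) (hK0 : μ K ≠ 0) (hKb : ∀ h ∈ K, ‖h‖ ≤ 1)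
    (hU : ∀ h ∈ K, ∀ t : ℝ, 0 ≤ t → ∀ x ∈ U, x + t • h ∈ U)
    {f : E → ℝ} {M : ℝ} (hM : 0 ≤ M) (hf1 : IntegrableOn f U μ)
    (hf2 : IntegrableOn (fun x => f x ^ 2) U μ)
    (hf : ∀ φ : E → ℝ, IsTestOn U φ → ∀ h : E,
      |∫ x in U, f x * fderiv ℝ φ x h ∂μ| ≤ ‖h‖ * M * √(∫ x in U, φ x ^ 2 ∂μ))
    {δ : ℝ} (hδ : 0 < δ) :
    ∫ x in U, f x ^ 2 ∂μ ≤ δ * M * √(∫ x in U, f x ^ 2 ∂μ)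
      + (μ.real K)⁻¹ * (δ ^ Module.finrank ℝ E)⁻¹ * (∫ x in U, |f x| ∂μ) ^ 2 := by
  have hUm := hUo.measurableSet
  set g := U.indicator (hf1.aestronglyMeasurable.mk f) with hg
  have hgf : ∀ᵐ x ∂μ.restrict U, g x = f x := by
    filter_upwards [hf1.aestronglyMeasurable.ae_eq_mk, ae_restrict_mem hUm] with x hx hxU
    rw [hg, indicator_of_mem hxU, hx]
  have hg0 : ∀ x, x ∉ U → g x = 0 := fun x hx => indicator_of_notMem hx _
  have hgm : Measurable g := hf1.aestronglyMeasurable.stronglyMeasurable_mk.measurable.indicator hUm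
  have hgi : g = U.indicator g := by simp [hg, indicator_indicator]
  have hg1 : Integrable g μ := by
    rw [hgi, integrable_indicator_iff hUm]
    exact hf1.congr (hgf.mono fun x hx => hx.symm)
  have hg2 : MemLp g 2 μ := by
    rw [memLp_two_iff_integrable_sq hg1.aestronglyMeasurable]
    have : (fun x => g x ^ 2) = U.indicator (fun x => g x ^ 2) := by
      ext x
      by_cases hx : x ∈ U
      · simp [hx]
      · simp [hx, hg0 x hx]
    rw [this, integrable_indicator_iff hUm]
    exact hf2.congr (hgf.mono fun x hx => by simp only [hx])
  have tr : ∀ w : ℝ → E → ℝ, (∀ x, w 0 x = 0) → ∫ x, w (g x) x ∂μ = ∫ x in U, w (f x) x ∂μ := by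
    intro w hw
    rw [← setIntegral_eq_integral_of_forall_compl_eq_zero (s := U)
      (fun x hx => by rw [hg0 x hx, hw])]
    exact integral_congr_ae (hgf.mono fun x hx => by simp only [hx])
  have key := WeakGradLE.integral_sq_le_of_cone (M := M) hUo hM (fun φ hφ h => ?_) hgm hg1 hg2 hg0
    hKm hK0 hKb hU hδ
  · rwa [tr (fun a _ => a ^ 2) (by simp), tr (fun a _ => |a|) (by simp)] at key
  · have h0 : ∀ x, x ∉ U → φ x ^ 2 = 0 := fun x hx => by
      rw [image_eq_zero_of_notMem_tsupport fun hx' => hx (hφ.2.2 hx')]; simp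
    rw [tr (fun a x => a * fderiv ℝ φ x h) (by simp),
      ← setIntegral_eq_integral_of_forall_compl_eq_zero h0]
    exact hf φ hφ h

end NashOnCone

theorem memLp_two_of_integrable_sq {X : Type*} [MeasurableSpace X] {ν : Measure X} {k : X → ℝ}
    (hk0 : ∀ x, 0 ≤ k x) (hk : Integrable (fun x => k x ^ 2) ν) : MemLp k 2 ν := by
  have hm : AEStronglyMeasurable k ν := by
    have := Real.continuous_sqrt.comp_aestronglyMeasurable hk.aestronglyMeasurable
    simpa [Real.sqrt_sq (hk0 _)] using this
  exact (memLp_two_iff_integrable_sq hm).2 hk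

/-- Cauchy-Schwarz for a dominated, possibly non-measurable, integrand. -/
theorem norm_integral_le_sqrt_mul_sqrt {X V : Type*} [MeasurableSpace X] [NormedAddCommGroup V]
    [NormedSpace ℝ V] {ν : Measure X} {φ k : X → ℝ} {w : X → V} (hφ : MemLp φ 2 ν)
    (hk0 : ∀ x, 0 ≤ k x) (hk : Integrable (fun x => k x ^ 2) ν)
    (hw : ∀ x, ‖w x‖ ≤ |φ x| * k x) :
    ‖∫ x, w x ∂ν‖ ≤ √(∫ x, k x ^ 2 ∂ν) * √(∫ x, φ x ^ 2 ∂ν) := by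
  have hk2 := memLp_two_of_integrable_sq hk0 hk
  have hφ2 : MemLp (fun x => |φ x|) 2 ν := hφ.abs
  refine (norm_integral_le_of_norm_le (MemLp.integrable_mul hφ2 hk2)
    (Filter.Eventually.of_forall hw)).trans ?_
  have := real_inner_le_norm (hφ2.toLp _) (hk2.toLp _)
  rw [inner_toLp_two_eq, norm_toLp_two_eq_sqrt, norm_toLp_two_eq_sqrt] at this
  rw [mul_comm (√_)]
  simpa using this

theorem pow_four_le_of_forall_pos {s M c N : ℝ} (hs : 0 ≤ s) (hM : 0 ≤ M) (hc : 0 ≤ c)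
    (H : ∀ δ : ℝ, 0 < δ → s ^ 2 ≤ δ * M * s + c * (δ ^ 2)⁻¹ * N ^ 2) :
    s ^ 4 ≤ 8 * c * M ^ 2 * N ^ 2 := by
  rcases hs.eq_or_lt with rfl | hs
  · rw [zero_pow four_ne_zero]; positivity
  rcases hM.eq_or_lt with rfl | hM
  · have h := H ((c * N ^ 2 + 1) / s ^ 2 + 1) (by positivity)
    set δ := (c * N ^ 2 + 1) / s ^ 2 + 1 with hδ
    have h1 : 1 ≤ δ := by rw [hδ]; linarith [show 0 ≤ (c * N ^ 2 + 1) / s ^ 2 by positivity]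
    have h2 : s ^ 2 * δ = c * N ^ 2 + 1 + s ^ 2 := by rw [hδ]; field_simp
    have h3 : s ^ 2 * δ ^ 2 ≤ c * N ^ 2 := by
      have : 0 < δ := by linarith
      field_simp at h
      linarith
    nlinarith [sq_nonneg N, sq_nonneg s, mul_nonneg (sq_nonneg s) (sub_nonneg.2 h1)]
  · have h := H (s / (2 * M)) (by positivity)
    have e1 : s / (2 * M) * M * s = s ^ 2 / 2 := by field_simp
    have e2 : c * ((s / (2 * M)) ^ 2)⁻¹ * N ^ 2 = 4 * c * M ^ 2 * N ^ 2 / s ^ 2 := by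
      field_simp; ring
    rw [e1, e2] at h
    have h' : s ^ 2 / 2 ≤ 4 * c * M ^ 2 * N ^ 2 / s ^ 2 := by linarith
    rw [le_div_iff₀ (by positivity)] at h'
    linarith [show s ^ 2 / 2 * s ^ 2 = s ^ 4 / 2 by ring]

theorem pow_three_le_of_forall_pos {s M c N : ℝ} (hs : 0 ≤ s) (hM : 0 ≤ M) (hc : 0 ≤ c)
    (H : ∀ δ : ℝ, 0 < δ → s ^ 2 ≤ δ * M * s + c * (δ ^ 1)⁻¹ * N ^ 2) :
    s ^ 3 ≤ 4 * c * M * N ^ 2 := by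
  rcases hs.eq_or_lt with rfl | hs
  · rw [zero_pow three_ne_zero]; positivity
  rcases hM.eq_or_lt with rfl | hM
  · have h := H ((c * N ^ 2 + 1) / s ^ 2) (by positivity)
    have e : c * (((c * N ^ 2 + 1) / s ^ 2) ^ 1)⁻¹ * N ^ 2
        = c * N ^ 2 * s ^ 2 / (c * N ^ 2 + 1) := by
      have : c * N ^ 2 + 1 ≠ 0 := by positivity
      field_simp
    rw [e, mul_zero, zero_mul, zero_add, le_div_iff₀ (by positivity)] at h
    nlinarith [pow_pos hs 2]
  · have h := H (s / (2 * M)) (by positivity)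
    have e1 : s / (2 * M) * M * s = s ^ 2 / 2 := by field_simp
    have e2 : c * ((s / (2 * M)) ^ 1)⁻¹ * N ^ 2 = 2 * c * M * N ^ 2 / s := by
      field_simp
    rw [e1, e2] at h
    have h' : s ^ 2 / 2 ≤ 2 * c * M * N ^ 2 / s := by linarith
    rw [le_div_iff₀ hs] at h'
    linarith [show s ^ 2 / 2 * s = s ^ 3 / 2 by ring]

/-- Nash's inequality on the half-line. -/
theorem exists_nash_halfLine : ∃ C > (0 : ℝ), ∀ g g' : ℝ → ℝ,
    IntegrableOn g (Ioi (0 : ℝ)) → IntegrableOn (fun x => g x ^ 2) (Ioi (0 : ℝ)) →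
    IntegrableOn (fun x => g' x ^ 2) (Ioi (0 : ℝ)) → IsWeakDerivOnHalfLine g g' →
    ∫ x in Ioi (0 : ℝ), g x ^ 2 ≤ C * (∫ x in Ioi (0 : ℝ), g' x ^ 2) ^ ((1 : ℝ) / 3) *
      (∫ x in Ioi (0 : ℝ), |g x|) ^ ((4 : ℝ) / 3) := by
  refine ⟨4 ^ ((2 : ℝ) / 3), by positivity, fun g g' hg1 hg2 hg' hw => ?_⟩
  set A := ∫ x in Ioi (0 : ℝ), g' x ^ 2
  set N := ∫ x in Ioi (0 : ℝ), |g x|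
  set X := ∫ x in Ioi (0 : ℝ), g x ^ 2
  have hA : 0 ≤ A := integral_nonneg fun x => sq_nonneg _
  have hN : 0 ≤ N := integral_nonneg fun x => abs_nonneg _
  have hX : 0 ≤ X := integral_nonneg fun x => sq_nonneg _
  have hcone : ∀ δ : ℝ, 0 < δ → √X ^ 2 ≤ δ * √A * √X + 1 * (δ ^ 1)⁻¹ * N ^ 2 := by
    intro δ hδ
    have := setIntegral_sq_le_of_cone (μ := (volume : Measure ℝ)) (U := Ioi 0) (K := Ioo 0 1)
      (f := g) (M := √A) isOpen_Ioi measurableSet_Ioo (by simp)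
      (fun h hh => by rw [Real.norm_of_nonneg hh.1.le]; exact hh.2.le)
      (fun h hh t ht x hx => by
        have : 0 ≤ t * h := mul_nonneg ht hh.1.le
        simp only [mem_Ioi, smul_eq_mul] at hx ⊢
        linarith)
      (Real.sqrt_nonneg _) hg1 hg2 (fun φ hφ h => ?_) hδ
    · simpa [Real.sq_sqrt hX] using this
    · have e : ∫ x in Ioi (0 : ℝ), g x * fderiv ℝ φ x h
          = h * -∫ x in Ioi (0 : ℝ), φ x * g' x := by
        rw [← hw φ hφ.1 hφ.2.1 hφ.2.2, ← integral_const_mul]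
        refine integral_congr_ae (Filter.Eventually.of_forall fun x => ?_)
        simp only [fderiv_eq_smul_deriv, smul_eq_mul]
        ring
      rw [e, abs_mul, abs_neg, Real.norm_eq_abs, mul_assoc]
      gcongr
      have hg'' : IntegrableOn (fun x => |g' x| ^ 2) (Ioi (0 : ℝ)) := by
        simpa only [sq_abs] using hg'
      have := norm_integral_le_sqrt_mul_sqrt (k := fun x => |g' x|)
        (w := fun x => φ x * g' x) (hφ.memLp (μ := volume.restrict (Ioi 0)) 2)
        (fun x => abs_nonneg _) hg'' (fun x => (abs_mul _ _).le)
      simp only [sq_abs] at this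
      exact this
  have h3 := pow_three_le_of_forall_pos (Real.sqrt_nonneg X) (Real.sqrt_nonneg A) zero_le_one hcone
  calc X = (√X ^ 3) ^ ((2 : ℝ) / 3) := by
        rw [← Real.rpow_natCast, ← Real.rpow_mul (Real.sqrt_nonneg _)]
        norm_num [Real.sq_sqrt hX]
    _ ≤ (4 * 1 * √A * N ^ 2) ^ ((2 : ℝ) / 3) :=
        Real.rpow_le_rpow (by positivity) h3 (by norm_num)
    _ = _ := by
        rw [mul_one, Real.mul_rpow (by positivity) (by positivity),
          Real.mul_rpow (by positivity) (by positivity), Real.sqrt_eq_rpow, ← Real.rpow_mul hA,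
          ← Real.rpow_natCast N, ← Real.rpow_mul hN]
        norm_num

/-- The intersection of `D₀ ε` with the open quadrant of signs `(s, t)`. -/
def exteriorQuadrant (ε s t : ℝ) : Set (EuclideanSpace ℝ (Fin 2)) :=
  (D₀ ε ∩ {x | 0 < s * x 0}) ∩ {x | 0 < t * x 1}

theorem isOpen_D₀ (ε : ℝ) : IsOpen (D₀ ε) := Metric.isClosed_closedBall.isOpen_compl

theorem mem_D₀_iff {ε : ℝ} {x : EuclideanSpace ℝ (Fin 2)} : x ∈ D₀ ε ↔ ε < ‖x‖ := by
  simp [D₀]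

theorem isOpen_setOf_pos_mul_coord (s : ℝ) (i : Fin 2) :
    IsOpen {x : EuclideanSpace ℝ (Fin 2) | 0 < s * x i} :=
  isOpen_lt (by fun_prop) (by fun_prop)

theorem isOpen_exteriorQuadrant (ε s t : ℝ) : IsOpen (exteriorQuadrant ε s t) :=
  ((isOpen_D₀ ε).inter (isOpen_setOf_pos_mul_coord s 0)).inter (isOpen_setOf_pos_mul_coord t 1)

theorem sq_le_add_sq_of_mul_pos {s a b : ℝ} (ha : 0 < s * a) (hb : 0 ≤ s * b) :
    a ^ 2 ≤ (a + b) ^ 2 := by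
  have hs : s ≠ 0 := by rintro rfl; simp at ha
  have h : 0 ≤ s ^ 2 * (a * b) := by nlinarith
  have h' : 0 ≤ a * b := nonneg_of_mul_nonneg_right h (by positivity)
  nlinarith [sq_nonneg b]

theorem add_smul_mem_exteriorQuadrant {ε s t : ℝ} {x h : EuclideanSpace ℝ (Fin 2)}
    (hx : x ∈ exteriorQuadrant ε s t) (hs : 0 < s * h 0) (ht : 0 < t * h 1) {r : ℝ} (hr : 0 ≤ r) :
    x + r • h ∈ exteriorQuadrant ε s t := by
  obtain ⟨⟨h1, h2⟩, h3⟩ := hx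
  simp only [mem_ofPred_eq] at h2 h3
  have e0 : 0 ≤ s * (r * h 0) := by have := mul_nonneg hr hs.le; linarith
  have e1 : 0 ≤ t * (r * h 1) := by have := mul_nonneg hr ht.le; linarith
  refine ⟨⟨?_, ?_⟩, ?_⟩
  · rw [mem_D₀_iff] at h1 ⊢
    refine h1.trans_le ?_
    rw [EuclideanSpace.norm_eq, EuclideanSpace.norm_eq]
    refine Real.sqrt_le_sqrt ?_
    simpa [Fin.sum_univ_two] using
      add_le_add (sq_le_add_sq_of_mul_pos h2 e0) (sq_le_add_sq_of_mul_pos h3 e1)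
  · simp only [mem_ofPred_eq, PiLp.add_apply, PiLp.smul_apply, smul_eq_mul]
    linarith
  · simp only [mem_ofPred_eq, PiLp.add_apply, PiLp.smul_apply, smul_eq_mul]
    linarith

theorem exists_nash_exteriorQuadrant (ε : ℝ) {s t : ℝ} (hs : s ≠ 0) (ht : t ≠ 0) :
    ∃ C > (0 : ℝ), ∀ (f : EuclideanSpace ℝ (Fin 2) → ℝ)
      (F : EuclideanSpace ℝ (Fin 2) → EuclideanSpace ℝ (Fin 2)),
      IntegrableOn f (D₀ ε) → IntegrableOn (fun x => f x ^ 2) (D₀ ε) →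
      IntegrableOn (fun x => ‖F x‖ ^ 2) (D₀ ε) → IsWeakGradientOn f F (D₀ ε) →
      ∫ x in exteriorQuadrant ε s t, f x ^ 2 ≤
        C * √(∫ x in D₀ ε, ‖F x‖ ^ 2) * ∫ x in D₀ ε, |f x| := by
  set K : Set (EuclideanSpace ℝ (Fin 2)) :=
    ({x | 0 < s * x 0} ∩ {x | 0 < t * x 1}) ∩ Metric.ball 0 1
  have hKo : IsOpen K := ((isOpen_setOf_pos_mul_coord s 0).inter
    (isOpen_setOf_pos_mul_coord t 1)).inter Metric.isOpen_ball
  have hKne : K.Nonempty := by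
    set v : EuclideanSpace ℝ (Fin 2) := !₂[s, t] with hv
    have hr : 0 < (‖v‖ + 1)⁻¹ := by positivity
    refine ⟨(‖v‖ + 1)⁻¹ • v, ⟨?_, ?_⟩, ?_⟩
    · have : 0 < (‖v‖ + 1)⁻¹ * s ^ 2 := by positivity
      simp only [mem_ofPred_eq, PiLp.smul_apply, smul_eq_mul]
      simp only [hv, PiLp.toLp_apply, Matrix.cons_val_zero] at this ⊢
      linarith
    · have : 0 < (‖v‖ + 1)⁻¹ * t ^ 2 := by positivity
      simp only [mem_ofPred_eq, PiLp.smul_apply, smul_eq_mul]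
      simp only [hv, PiLp.toLp_apply, Matrix.cons_val_one, Matrix.cons_val_fin_one] at this ⊢
      linarith
    · rw [mem_ball_zero_iff, norm_smul, Real.norm_of_nonneg hr.le, inv_mul_lt_iff₀ (by positivity)]
      linarith
  have hK0 : volume K ≠ 0 := (hKo.measure_pos volume hKne).ne'
  set c := (volume.real K)⁻¹
  have hc0 : 0 ≤ c := by positivity
  refine ⟨√(8 * c) + 1, by positivity, fun f F hf1 hf2 hF hw => ?_⟩
  set Q := exteriorQuadrant ε s t
  have hQo : IsOpen Q := isOpen_exteriorQuadrant ε s t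
  have hQD : Q ⊆ D₀ ε := inter_subset_left.trans inter_subset_left
  set A := ∫ x in D₀ ε, ‖F x‖ ^ 2
  set N := ∫ x in D₀ ε, |f x|
  set X := ∫ x in Q, f x ^ 2
  have hA : 0 ≤ A := integral_nonneg fun x => sq_nonneg _
  have hN : 0 ≤ N := integral_nonneg fun x => abs_nonneg _
  have hX : 0 ≤ X := integral_nonneg fun x => sq_nonneg _
  have hNQ : ∫ x in Q, |f x| ≤ N :=
    setIntegral_mono_set hf1.abs (Filter.Eventually.of_forall fun x => abs_nonneg _)
      hQD.eventuallyLE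
  have hcone : ∀ δ : ℝ, 0 < δ → √X ^ 2 ≤ δ * √A * √X + c * (δ ^ 2)⁻¹ * N ^ 2 := by
    intro δ hδ
    have := setIntegral_sq_le_of_cone (μ := (volume : Measure (EuclideanSpace ℝ (Fin 2))))
      (K := K) (f := f) (M := √A) hQo hKo.measurableSet hK0
      (fun h hh => (mem_ball_zero_iff.1 hh.2).le)
      (fun h hh r hr x hx => add_smul_mem_exteriorQuadrant hx hh.1.1 hh.1.2 hr)
      (Real.sqrt_nonneg _) (hf1.mono_set hQD) (hf2.mono_set hQD) (fun φ hφ h => ?_) hδ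
    · rw [Real.sq_sqrt hX]
      rw [finrank_euclideanSpace_fin] at this
      refine this.trans ?_
      have hn : 0 ≤ ∫ x in Q, |f x| := integral_nonneg fun x => abs_nonneg _
      gcongr
    · have hφD : IsTestOn (D₀ ε) φ := ⟨hφ.1, hφ.2.1, hφ.2.2.trans hQD⟩
      have hsupp : ∀ x, x ∉ Q → φ x = 0 := fun x hx =>
        image_eq_zero_of_notMem_tsupport fun hx' => hx (hφ.2.2 hx')
      have hsupp' : ∀ x, x ∉ Q → fderiv ℝ φ x = 0 := fun x hx =>
        image_eq_zero_of_notMem_tsupport fun hx' =>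
          hx (hφ.2.2 (tsupport_fderiv_subset ℝ hx'))
      have hgc : Continuous (gradient φ) :=
        (InnerProductSpace.toDual ℝ (EuclideanSpace ℝ (Fin 2))).symm.continuous.comp
          (hφ.1.continuous_fderiv (by simp))
      have hgs : HasCompactSupport (gradient φ) :=
        (hφ.2.1.fderiv ℝ).comp_left (map_zero _)
      obtain ⟨B, hB⟩ := hgc.bounded_above_of_compact_support hgs
      have hbound : Integrable (fun x => f x • gradient φ x) (volume.restrict (D₀ ε)) :=
        Integrable.smul_bdd hf1 B hgc.aestronglyMeasurable
          (Filter.Eventually.of_forall hB)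
      have e : ∫ x in Q, f x * fderiv ℝ φ x h
          = inner ℝ h (-∫ x in D₀ ε, φ x • F x) := by
        rw [← hw φ hφD.1 hφD.2.1 hφD.2.2, ← integral_inner hbound h,
          setIntegral_eq_integral_of_forall_compl_eq_zero
            (fun x hx => by rw [hsupp' x hx]; simp),
          setIntegral_eq_integral_of_forall_compl_eq_zero
            (fun x hx => by
              rw [gradient, hsupp' x fun hx' => hx (hQD hx')]; simp)]
        refine integral_congr_ae (Filter.Eventually.of_forall fun x => ?_)
        simp only [inner_smul_right]
        rw [real_inner_comm, inner_gradient_left]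
      have e2 : ∫ x in Q, φ x ^ 2 = ∫ x in D₀ ε, φ x ^ 2 := by
        rw [setIntegral_eq_integral_of_forall_compl_eq_zero
            (fun x hx => by rw [hsupp x hx]; simp),
          setIntegral_eq_integral_of_forall_compl_eq_zero
            (fun x hx => by rw [hsupp x fun hx' => hx (hQD hx')]; simp)]
      rw [e, e2, mul_assoc]
      refine (abs_real_inner_le_norm _ _).trans ?_
      rw [norm_neg]
      gcongr
      exact norm_integral_le_sqrt_mul_sqrt (k := fun x => ‖F x‖)
        (hφ.memLp (μ := volume.restrict (D₀ ε)) 2)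
        (fun x => norm_nonneg _) hF (fun x => (norm_smul _ _).le)
  have h4 := pow_four_le_of_forall_pos (Real.sqrt_nonneg X) (Real.sqrt_nonneg A) hc0 hcone
  have hX4 : X ^ 2 ≤ (√(8 * c) * √A * N) ^ 2 := by
    calc X ^ 2 = √X ^ 4 := by rw [show (4 : ℕ) = 2 * 2 from rfl, pow_mul, Real.sq_sqrt hX]
      _ ≤ _ := h4
      _ = _ := by rw [mul_pow, mul_pow, Real.sq_sqrt (by positivity : (0:ℝ) ≤ 8 * c)]
  have := (pow_le_pow_iff_left₀ hX (by positivity) two_ne_zero).1 hX4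
  refine this.trans ?_
  gcongr
  linarith

/-- Splitting an integral along a coordinate hyperplane. -/
theorem setIntegral_eq_add_of_coord_sign {S : Set (EuclideanSpace ℝ (Fin 2))}
    {w : EuclideanSpace ℝ (Fin 2) → ℝ} (hw : IntegrableOn w S) (i : Fin 2) :
    ∫ x in S, w x = (∫ x in S ∩ {x | 0 < (1 : ℝ) * x i}, w x)
      + ∫ x in S ∩ {x | 0 < (-1 : ℝ) * x i}, w x := by
  rw [← integral_inter_add_sdiff (isOpen_setOf_pos_mul_coord 1 i).measurableSet hw]
  congr 1
  refine setIntegral_congr_set ?_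
  have hnull : volume {x : EuclideanSpace ℝ (Fin 2) | x i = 0} = 0 := by
    refine Measure.addHaar_submodule volume
      (LinearMap.ker (EuclideanSpace.proj (𝕜 := ℝ) i : EuclideanSpace ℝ (Fin 2) →L[ℝ] ℝ).toLinearMap)
      fun h => ?_
    have : EuclideanSpace.single i (1 : ℝ) ∈ LinearMap.ker
        (EuclideanSpace.proj (𝕜 := ℝ) i : EuclideanSpace ℝ (Fin 2) →L[ℝ] ℝ).toLinearMap := by
      rw [h]; trivial
    simp at this
  have hae : ∀ᵐ x : EuclideanSpace ℝ (Fin 2), x i ≠ 0 := by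
    rw [ae_iff]; simpa using hnull
  filter_upwards [hae] with x hx
  refine propext (and_congr_right fun _ => ?_)
  change ¬ (0 < (1 : ℝ) * x i) ↔ 0 < (-1 : ℝ) * x i
  rw [one_mul, not_lt, neg_one_mul, neg_pos]
  exact ⟨fun h => lt_of_le_of_ne h hx, le_of_lt⟩

/-- Nash's inequality on the exterior of a disk in the plane. -/
theorem exists_nash_D₀ (ε : ℝ) :
    ∃ C > (0 : ℝ), ∀ (f : EuclideanSpace ℝ (Fin 2) → ℝ)
      (F : EuclideanSpace ℝ (Fin 2) → EuclideanSpace ℝ (Fin 2)),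
      IntegrableOn f (D₀ ε) → IntegrableOn (fun x => f x ^ 2) (D₀ ε) →
      IntegrableOn (fun x => ‖F x‖ ^ 2) (D₀ ε) → IsWeakGradientOn f F (D₀ ε) →
      ∫ x in D₀ ε, f x ^ 2 ≤ C * √(∫ x in D₀ ε, ‖F x‖ ^ 2) * ∫ x in D₀ ε, |f x| := by
  have h1 : (1 : ℝ) ≠ 0 := one_ne_zero
  have h2 : (-1 : ℝ) ≠ 0 := by norm_num
  obtain ⟨C₁, hC₁, H₁⟩ := exists_nash_exteriorQuadrant ε h1 h1
  obtain ⟨C₂, hC₂, H₂⟩ := exists_nash_exteriorQuadrant ε h1 h2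
  obtain ⟨C₃, hC₃, H₃⟩ := exists_nash_exteriorQuadrant ε h2 h1
  obtain ⟨C₄, hC₄, H₄⟩ := exists_nash_exteriorQuadrant ε h2 h2
  refine ⟨C₁ + C₂ + C₃ + C₄, by positivity, fun f F hf1 hf2 hF hw => ?_⟩
  rw [setIntegral_eq_add_of_coord_sign hf2 0,
    setIntegral_eq_add_of_coord_sign (hf2.mono_set inter_subset_left) 1,
    setIntegral_eq_add_of_coord_sign (hf2.mono_set inter_subset_left) 1]
  have := H₁ f F hf1 hf2 hF hw
  have := H₂ f F hf1 hf2 hF hw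
  have := H₃ f F hf1 hf2 hF hw
  have := H₄ f F hf1 hf2 hF hw
  simp only [exteriorQuadrant] at *
  linarith

/-- Nash-type inequality for the Dirichlet form of Brownian motion with varying dimension,
written componentwise on the plane part `D₀` and the pole part `(0,∞)`. -/
theorem nash_type_inequality_BMVD (ε p : ℝ) (hε : 0 < ε) (hp : 0 < p) :
    ∃ C > (0 : ℝ),
      ∀ (f : EuclideanSpace ℝ (Fin 2) → ℝ)
        (F : EuclideanSpace ℝ (Fin 2) → EuclideanSpace ℝ (Fin 2))
        (g g' : ℝ → ℝ),
        IntegrableOn f (D₀ ε) →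
        IntegrableOn (fun x => f x ^ 2) (D₀ ε) →
        IntegrableOn (fun x => ‖F x‖ ^ 2) (D₀ ε) →
        IsWeakGradientOn f F (D₀ ε) →
        IntegrableOn g (Set.Ioi (0 : ℝ)) →
        IntegrableOn (fun x => g x ^ 2) (Set.Ioi (0 : ℝ)) →
        IntegrableOn (fun x => g' x ^ 2) (Set.Ioi (0 : ℝ)) →
        IsWeakDerivOnHalfLine g g' →
        (∫ x in D₀ ε, f x ^ 2) + p * ∫ x in Set.Ioi (0 : ℝ), g x ^ 2 ≤
          C * (((1 / 2) * (∫ x in D₀ ε, ‖F x‖ ^ 2)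
                  + (p / 2) * ∫ x in Set.Ioi (0 : ℝ), g' x ^ 2) ^ ((1 : ℝ) / 2) *
                ((∫ x in D₀ ε, |f x|) + p * ∫ x in Set.Ioi (0 : ℝ), |g x|)
              + ((1 / 2) * (∫ x in D₀ ε, ‖F x‖ ^ 2)
                  + (p / 2) * ∫ x in Set.Ioi (0 : ℝ), g' x ^ 2) ^ ((1 : ℝ) / 3) *
                ((∫ x in D₀ ε, |f x|) + p * ∫ x in Set.Ioi (0 : ℝ), |g x|) ^ ((4 : ℝ) / 3)) := by
  obtain ⟨C₁, hC₁, H₁⟩ := exists_nash_D₀ ε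
  obtain ⟨C₂, hC₂, H₂⟩ := exists_nash_halfLine
  refine ⟨C₁ * √2 + p * C₂ * (2 / p) ^ ((1 : ℝ) / 3) * (1 / p) ^ ((4 : ℝ) / 3), by positivity,
    fun f F g g' hf1 hf2 hF hfF hg1 hg2 hg' hgg' => ?_⟩
  have h1 := H₁ f F hf1 hf2 hF hfF
  have h2 := H₂ g g' hg1 hg2 hg' hgg'
  have hA : 0 ≤ ∫ x in D₀ ε, ‖F x‖ ^ 2 := integral_nonneg fun x => sq_nonneg _
  have hB : 0 ≤ ∫ x in Ioi (0 : ℝ), g' x ^ 2 := integral_nonneg fun x => sq_nonneg _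
  have hN : 0 ≤ ∫ x in D₀ ε, |f x| := integral_nonneg fun x => abs_nonneg _
  have hL : 0 ≤ ∫ x in Ioi (0 : ℝ), |g x| := integral_nonneg fun x => abs_nonneg _
  set A := ∫ x in D₀ ε, ‖F x‖ ^ 2
  set B := ∫ x in Ioi (0 : ℝ), g' x ^ 2
  set N := ∫ x in D₀ ε, |f x|
  set L := ∫ x in Ioi (0 : ℝ), |g x|
  have hE : 0 ≤ 1 / 2 * A + p / 2 * B := by positivity
  have hT : 0 ≤ N + p * L := by positivity
  have hAE : A ≤ 2 * (1 / 2 * A + p / 2 * B) := by linarith [mul_nonneg hp.le hB]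
  have hBE : B ≤ 2 / p * (1 / 2 * A + p / 2 * B) := by
    rw [div_mul_eq_mul_div, le_div_iff₀ hp]; linarith
  have hNT : N ≤ N + p * L := by linarith [mul_nonneg hp.le hL]
  have hLT : L ≤ 1 / p * (N + p * L) := by
    rw [div_mul_eq_mul_div, le_div_iff₀ hp]; linarith
  generalize 1 / 2 * A + p / 2 * B = E at *
  generalize N + p * L = T at *
  have hf : C₁ * √A * N ≤ C₁ * √2 * (E ^ ((1 : ℝ) / 2) * T) := by
    calc C₁ * √A * N ≤ C₁ * √(2 * E) * T := by gcongr
      _ = _ := by rw [Real.sqrt_mul zero_le_two, Real.sqrt_eq_rpow E]; ring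
  have hg : p * (C₂ * B ^ ((1 : ℝ) / 3) * L ^ ((4 : ℝ) / 3)) ≤
      p * C₂ * (2 / p) ^ ((1 : ℝ) / 3) * (1 / p) ^ ((4 : ℝ) / 3)
        * (E ^ ((1 : ℝ) / 3) * T ^ ((4 : ℝ) / 3)) := by
    calc p * (C₂ * B ^ ((1 : ℝ) / 3) * L ^ ((4 : ℝ) / 3))
        ≤ p * (C₂ * (2 / p * E) ^ ((1 : ℝ) / 3) * (1 / p * T) ^ ((4 : ℝ) / 3)) := by gcongr
      _ = _ := by
        rw [Real.mul_rpow (by positivity) hE, Real.mul_rpow (by positivity) hT]; ring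
  have hp2 := mul_le_mul_of_nonneg_left h2 hp.le
  have c1 : 0 ≤ C₁ * √2 * (E ^ ((1 : ℝ) / 3) * T ^ ((4 : ℝ) / 3)) := by positivity
  have c2 : 0 ≤ p * C₂ * (2 / p) ^ ((1 : ℝ) / 3) * (1 / p) ^ ((4 : ℝ) / 3)
      * (E ^ ((1 : ℝ) / 2) * T) := by positivity
  linarith
end

section
/- For every real x > 0, (1/(1+x)) · e^{−x²/2} ≤ ∫ₓ^∞ e^{−y²/2} dy ≤ (eπ/(1+x)) · e^{−x²/2}. -/
open MeasureTheory Set Real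

theorem hasDerivAt_neg_exp_neg_sq_div_two_div_one_add {y : ℝ} (hy : 1 + y ≠ 0) :
    HasDerivAt (fun y : ℝ => -(Real.exp (-y ^ 2 / 2) / (1 + y)))
      ((y ^ 2 + y + 1) / (1 + y) ^ 2 * Real.exp (-y ^ 2 / 2)) y := by
  have h1 : HasDerivAt (fun y : ℝ => -y ^ 2 / 2) (-y) y := by
    refine ((hasDerivAt_pow 2 y).neg.div_const 2).congr_deriv ?_
    norm_num
    ring
  have h2 : HasDerivAt (fun y : ℝ => 1 + y) 1 y := (hasDerivAt_id y).const_add 1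
  refine (h1.exp.div h2 hy).neg.congr_deriv ?_
  field_simp
  ring

theorem tendsto_neg_exp_neg_sq_div_two_div_one_add :
    Filter.Tendsto (fun y : ℝ => -(Real.exp (-y ^ 2 / 2) / (1 + y))) Filter.atTop (nhds 0) := by
  have h : Filter.Tendsto (fun y : ℝ => Real.exp (-y ^ 2 / 2) / (1 + y))
      Filter.atTop (nhds 0) := by
    have hinv : Filter.Tendsto (fun y : ℝ => (1 + y)⁻¹) Filter.atTop (nhds 0) :=
      tendsto_inv_atTop_zero.comp (Filter.tendsto_atTop_add_const_left _ 1 Filter.tendsto_id)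
    refine squeeze_zero' ?_ ?_ hinv
    · filter_upwards [Filter.eventually_ge_atTop 0] with y hy
      positivity
    · filter_upwards [Filter.eventually_ge_atTop 0] with y hy
      rw [div_eq_mul_inv]
      refine mul_le_of_le_one_left (by positivity) (Real.exp_le_one_iff.mpr ?_)
      nlinarith [sq_nonneg y]
  simpa using h.neg

theorem gaussian_tail_two_sided (x : ℝ) (hx : 0 < x) :
    (1 / (1 + x)) * Real.exp (-x ^ 2 / 2) ≤ ∫ y in Set.Ici x, Real.exp (-y ^ 2 / 2) ∧
    ∫ y in Set.Ici x, Real.exp (-y ^ 2 / 2) ≤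
      (Real.exp 1 * Real.pi / (1 + x)) * Real.exp (-x ^ 2 / 2) := by
  rw [integral_Ici_eq_integral_Ioi]
  have hderiv : ∀ y ∈ Ici x, HasDerivAt (fun y : ℝ => -(Real.exp (-y ^ 2 / 2) / (1 + y)))
      ((y ^ 2 + y + 1) / (1 + y) ^ 2 * Real.exp (-y ^ 2 / 2)) y := fun y hy =>
    hasDerivAt_neg_exp_neg_sq_div_two_div_one_add (by linarith [mem_Ici.mp hy])
  have hint : IntegrableOn
      (fun y : ℝ => (y ^ 2 + y + 1) / (1 + y) ^ 2 * Real.exp (-y ^ 2 / 2)) (Ioi x) := by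
    refine integrableOn_Ioi_deriv_of_nonneg' hderiv (fun y hy => ?_)
      tendsto_neg_exp_neg_sq_div_two_div_one_add
    have hy0 : 0 < y := hx.trans hy
    positivity
  have hval := integral_Ioi_of_hasDerivAt_of_tendsto' hderiv hint
    tendsto_neg_exp_neg_sq_div_two_div_one_add
  have hgauss : IntegrableOn (fun y : ℝ => Real.exp (-y ^ 2 / 2)) (Ioi x) := by
    convert (integrable_exp_neg_mul_sq (b := 1 / 2) (by norm_num)).integrableOn using 3
    ring
  have hlower := setIntegral_mono_on hint hgauss measurableSet_Ioi (fun y hy => by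
    have hy0 : 0 < y := hx.trans hy
    refine mul_le_of_le_one_left (Real.exp_pos _).le ?_
    rw [div_le_one (by positivity)]
    nlinarith)
  have hupper := setIntegral_mono_on hgauss (hint.const_mul (4 / 3)) measurableSet_Ioi
    (fun y hy => by
      have hy0 : 0 < y := hx.trans hy
      rw [← mul_assoc]
      refine le_mul_of_one_le_left (Real.exp_pos _).le ?_
      rw [← mul_div_assoc, one_le_div (by positivity)]
      nlinarith [sq_nonneg (y - 1)])
  rw [integral_const_mul] at hupper
  rw [hval] at hlower hupper
  have hconst : 4 / 3 ≤ Real.exp 1 * Real.pi := by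
    nlinarith [Real.pi_gt_three, Real.add_one_le_exp (1 : ℝ)]
  constructor
  · calc _ = 0 - -(Real.exp (-x ^ 2 / 2) / (1 + x)) := by ring
      _ ≤ _ := hlower
  · calc _ ≤ _ := hupper
      _ = 4 / 3 * (Real.exp (-x ^ 2 / 2) / (1 + x)) := by ring
      _ ≤ Real.exp 1 * Real.pi * (Real.exp (-x ^ 2 / 2) / (1 + x)) := by gcongr
      _ = _ := by ring
end

section
/- For every constant c > 0 there exists a constant C ≥ 1 such that for every t ≥ 3 and every y with 0 < y ≤ √t, one has C⁻¹ · log t ≤ ∫₂ᵗ (1/s) · (1 + (y · log s)/√s) · e^{−c y²/s} ds ≤ C · log t. -/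
open MeasureTheory Set Real

lemma continuousOn_log_integrand (c y : ℝ) {a b : ℝ} (ha : 0 < a) :
    ContinuousOn (fun s : ℝ => (1 / s) * (1 + y * Real.log s / Real.sqrt s) *
      Real.exp (-c * y ^ 2 / s)) (Set.Icc a b) := by
  have h0 : ∀ s ∈ Set.Icc a b, s ≠ 0 := fun s hs => (ha.trans_le hs.1).ne'
  have h1 : ∀ s ∈ Set.Icc a b, Real.sqrt s ≠ 0 := fun s hs =>
    (Real.sqrt_pos.2 (ha.trans_le hs.1)).ne'
  have hlog : ContinuousOn Real.log (Set.Icc a b) := continuousOn_id.log h0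
  have hsqrt : ContinuousOn Real.sqrt (Set.Icc a b) := Real.continuous_sqrt.continuousOn
  exact ((continuousOn_const.div continuousOn_id h0).mul
    (continuousOn_const.add ((continuousOn_const.mul hlog).div hsqrt h1))).mul
    (Real.continuous_exp.comp_continuousOn (continuousOn_const.div continuousOn_id h0))

lemma mul_log_sub_log_le_setIntegral {f : ℝ → ℝ} {K a b t : ℝ}
    (hf : ContinuousOn f (Set.Icc 2 t)) (hpos : ∀ s ∈ Set.Icc 2 t, 0 ≤ f s)
    (ha : 2 ≤ a) (hab : a ≤ b) (hbt : b ≤ t) (hK : ∀ s ∈ Set.Icc a b, K * s⁻¹ ≤ f s) :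
    K * (Real.log b - Real.log a) ≤ ∫ s in Set.Icc 2 t, f s := by
  have hsub : Set.Icc a b ⊆ Set.Icc 2 t := Set.Icc_subset_Icc ha hbt
  have hint : IntegrableOn f (Set.Icc 2 t) := hf.integrableOn_Icc
  have hinv : ContinuousOn (fun s : ℝ => K * s⁻¹) (Set.Icc a b) :=
    continuousOn_const.mul (continuousOn_id.inv₀ fun s hs => by
      have := hs.1
      simp only [id]
      linarith)
  calc K * (Real.log b - Real.log a) = ∫ s in Set.Icc a b, K * s⁻¹ := by
        rw [integral_Icc_eq_integral_Ioc, ← intervalIntegral.integral_of_le hab,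
          intervalIntegral.integral_const_mul, integral_inv_of_pos (by linarith) (by linarith),
          Real.log_div (by linarith) (by linarith)]
    _ ≤ ∫ s in Set.Icc a b, f s :=
        setIntegral_mono_on hinv.integrableOn_Icc (hint.mono_set hsub) measurableSet_Icc hK
    _ ≤ ∫ s in Set.Icc 2 t, f s :=
        setIntegral_mono_set hint ((ae_restrict_iff' measurableSet_Icc).2 (.of_forall hpos))
          hsub.eventuallyLE

lemma hasDerivAt_log_sub_arctan {c y s : ℝ} (hc : 0 < c) (hs : 0 < s) (l : ℝ) :
    HasDerivAt (fun s : ℝ => Real.log s -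
        2 / Real.sqrt c * l * Real.arctan (Real.sqrt c * y / Real.sqrt s))
      (1 / s + l * (y / (s * Real.sqrt s)) / (1 + c * y ^ 2 / s)) s := by
  have hr : 0 < Real.sqrt s := Real.sqrt_pos.2 hs
  have hk : 0 < Real.sqrt c := Real.sqrt_pos.2 hc
  have hr2 : Real.sqrt s ^ 2 = s := Real.sq_sqrt hs.le
  have hk2 : Real.sqrt c ^ 2 = c := Real.sq_sqrt hc.le
  have h := (Real.hasDerivAt_log hs.ne').sub
    (((hasDerivAt_const s (Real.sqrt c * y)).div
      (Real.hasDerivAt_sqrt hs.ne') hr.ne').arctan.const_mul (2 / Real.sqrt c * l))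
  refine h.congr_deriv ?_
  have e : (Real.sqrt c * y / Real.sqrt s) ^ 2 = c * y ^ 2 / s := by
    rw [div_pow, mul_pow, hk2, hr2]
  have hd : 1 + c * y ^ 2 / s ≠ 0 := by positivity
  simp only [Pi.div_apply] at *
  rw [e, hr2]
  generalize 1 + c * y ^ 2 / s = d at *
  field_simp
  ring

lemma log_integral_le {c t y : ℝ} (hc : 0 < c) (ht : 3 ≤ t) (hy : 0 < y) :
    (∫ s in Set.Icc (2 : ℝ) t,
      (1 / s) * (1 + y * Real.log s / Real.sqrt s) * Real.exp (-c * y ^ 2 / s)) ≤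
      (1 + π / Real.sqrt c) * Real.log t := by
  have hl : 0 < Real.log t := Real.log_pos (by linarith)
  have hk : 0 < Real.sqrt c := Real.sqrt_pos.2 hc
  have h2t : (2 : ℝ) ≤ t := by linarith
  have hcont : ContinuousOn (fun s : ℝ => 1 / s + Real.log t * (y / (s * Real.sqrt s)) /
      (1 + c * y ^ 2 / s)) (Set.Icc 2 t) := by
    intro s hs
    have hs0 : 0 < s := by linarith [hs.1]
    have hr : 0 < Real.sqrt s := Real.sqrt_pos.2 hs0
    have h1 : s * Real.sqrt s ≠ 0 := by positivity
    have h2 : 1 + c * y ^ 2 / s ≠ 0 := by positivity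
    have h3 : s ≠ 0 := hs0.ne'
    apply ContinuousAt.continuousWithinAt
    fun_prop (disch := assumption)
  calc _ ≤ ∫ s in Set.Icc (2 : ℝ) t, (1 / s + Real.log t * (y / (s * Real.sqrt s)) /
      (1 + c * y ^ 2 / s)) := by
        refine setIntegral_mono_on (continuousOn_log_integrand c y two_pos).integrableOn_Icc
          hcont.integrableOn_Icc measurableSet_Icc fun s hs => ?_
        have hs0 : 0 < s := by linarith [hs.1]
        have hr : 0 < Real.sqrt s := Real.sqrt_pos.2 hs0
        have hx : 0 ≤ c * y ^ 2 / s := by positivity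
        have hexp : Real.exp (-c * y ^ 2 / s) ≤ (1 + c * y ^ 2 / s)⁻¹ := by
          rw [show -c * y ^ 2 / s = -(c * y ^ 2 / s) by ring, Real.exp_neg]
          exact inv_anti₀ (by positivity) (by linarith [Real.add_one_le_exp (c * y ^ 2 / s)])
        have hexp1 : Real.exp (-c * y ^ 2 / s) ≤ 1 :=
          hexp.trans (inv_le_one_of_one_le₀ (by linarith))
        have hls : Real.log s ≤ Real.log t := Real.log_le_log hs0 hs.2
        calc _ = 1 / s * Real.exp (-c * y ^ 2 / s) +
              Real.log s * (y / (s * Real.sqrt s)) * Real.exp (-c * y ^ 2 / s) := by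
                field_simp
          _ ≤ 1 / s * 1 + Real.log t * (y / (s * Real.sqrt s)) * (1 + c * y ^ 2 / s)⁻¹ := by
                gcongr
          _ = _ := by rw [mul_one, div_eq_mul_inv _ (1 + c * y ^ 2 / s)]
    _ = (Real.log t - 2 / Real.sqrt c * Real.log t *
            Real.arctan (Real.sqrt c * y / Real.sqrt t)) -
          (Real.log 2 - 2 / Real.sqrt c * Real.log t *
            Real.arctan (Real.sqrt c * y / Real.sqrt 2)) := by
        rw [integral_Icc_eq_integral_Ioc, ← intervalIntegral.integral_of_le h2t]
        refine intervalIntegral.integral_eq_sub_of_hasDerivAt (f := fun s : ℝ => Real.log s -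
          2 / Real.sqrt c * Real.log t * Real.arctan (Real.sqrt c * y / Real.sqrt s))
          (fun s hs => ?_) (hcont.intervalIntegrable_of_Icc h2t)
        rw [Set.uIcc_of_le h2t] at hs
        exact hasDerivAt_log_sub_arctan hc (by linarith [hs.1]) _
    _ ≤ _ := by
        have h1 : 0 ≤ Real.arctan (Real.sqrt c * y / Real.sqrt t) :=
          Real.arctan_nonneg.2 (by positivity)
        have h2 := (Real.arctan_lt_pi_div_two (Real.sqrt c * y / Real.sqrt 2)).le
        have h3 : 0 < Real.log 2 := Real.log_pos one_lt_two
        have h4 : 0 ≤ 2 / Real.sqrt c * Real.log t := by positivity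
        have h5 := mul_le_mul_of_nonneg_left h2 h4
        have h6 := mul_nonneg h4 h1
        have h7 : 2 / Real.sqrt c * Real.log t * (π / 2) = π / Real.sqrt c * Real.log t := by
          field_simp
        linarith

lemma le_log_integral {c t y : ℝ} (hc : 0 < c) (ht : 3 ≤ t) (hy : 0 < y)
    (hyt : y ≤ Real.sqrt t) :
    Real.exp (-(3 / 2 * c)) / 18 * Real.log t ≤
      ∫ s in Set.Icc (2 : ℝ) t,
        (1 / s) * (1 + y * Real.log s / Real.sqrt s) * Real.exp (-c * y ^ 2 / s) := by
  have hl : 0 < Real.log t := Real.log_pos (by linarith)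
  have hE : 0 < Real.exp (-(3 / 2 * c)) := Real.exp_pos _
  have hf := continuousOn_log_integrand c y (b := t) two_pos
  have hpos : ∀ s ∈ Set.Icc 2 t, 0 ≤ (1 / s) * (1 + y * Real.log s / Real.sqrt s) *
      Real.exp (-c * y ^ 2 / s) := fun s hs => by
    have hs0 : 0 < s := by linarith [hs.1]
    have := Real.log_nonneg (by linarith [hs.1] : 1 ≤ s)
    positivity
  have hexp : ∀ s, 2 ≤ s → 2 / 3 * y ^ 2 ≤ s →
      Real.exp (-(3 / 2 * c)) ≤ Real.exp (-c * y ^ 2 / s) := fun s hs hys => by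
    apply Real.exp_le_exp.2
    rw [le_div_iff₀ (by linarith)]
    nlinarith
  have hr0 : 0 < Real.sqrt t := Real.sqrt_pos.2 (by linarith)
  have hr2 : Real.sqrt t ^ 2 = t := Real.sq_sqrt (by linarith)
  have hr1 : 1 < Real.sqrt t := by nlinarith
  have hyt2 : y ^ 2 ≤ t := by nlinarith
  by_cases h : y ^ 2 ≤ max 3 (Real.sqrt t)
  · obtain ⟨m, hm2, hmy, hmt, hm3⟩ : ∃ m : ℝ, 2 ≤ m ∧ 2 / 3 * y ^ 2 ≤ m ∧ m ≤ t ∧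
        m ^ 3 ≤ t ^ 2 := by
      rcases le_total (Real.sqrt t) 3 with h3 | h3
      · rw [max_eq_left h3] at h
        exact ⟨2, le_rfl, by linarith, by linarith, by nlinarith⟩
      · rw [max_eq_right h3] at h
        refine ⟨2 / 3 * Real.sqrt t, by linarith, by linarith, by nlinarith, ?_⟩
        have : t ^ 2 = Real.sqrt t ^ 3 * Real.sqrt t := by
          rw [← hr2, Real.sqrt_sq hr0.le]; ring
        rw [this, mul_pow, mul_comm]
        gcongr
        linarith
    have hlog : 3 * Real.log m ≤ 2 * Real.log t := by
      have := Real.log_le_log (by positivity) hm3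
      rw [Real.log_pow, Real.log_pow] at this
      exact_mod_cast this
    refine le_trans ?_ (mul_log_sub_log_le_setIntegral (K := Real.exp (-(3 / 2 * c)))
      hf hpos hm2 hmt le_rfl fun s hs => ?_)
    · nlinarith
    · have hs2 : 2 ≤ s := hm2.trans hs.1
      have hlog := Real.log_nonneg (by linarith : 1 ≤ s)
      have hs0 : 0 < s := by linarith
      have h1 : 1 ≤ 1 + y * Real.log s / Real.sqrt s := le_add_of_nonneg_right (by positivity)
      rw [mul_comm, one_div]
      have := hexp s hs2 (hmy.trans hs.1)
      gcongr
      exact le_mul_of_one_le_right (by positivity) h1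
  · rw [not_le, max_lt_iff] at h
    obtain ⟨h3, hrt⟩ := h
    have hlog1 : Real.log t ≤ 2 * Real.log (y ^ 2) := by
      have := Real.log_le_log hr0 hrt.le
      rw [Real.log_sqrt (by linarith)] at this
      linarith
    have hlog2 : Real.log (y ^ 2) ≤ 3 * Real.log (2 / 3 * y ^ 2) := by
      have : y ^ 2 ≤ (2 / 3 * y ^ 2) ^ 3 := by
        nlinarith [mul_pos (by linarith : 0 < y ^ 2) (by nlinarith : 0 < 8 / 27 * (y ^ 2) ^ 2 - 1)]
      have := Real.log_le_log (by positivity) this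
      rw [Real.log_pow (n := 3)] at this
      exact_mod_cast this
    have hgap : 1 / 3 ≤ Real.log (y ^ 2) - Real.log (2 / 3 * y ^ 2) := by
      rw [← Real.log_div (by positivity) (by positivity)]
      have := Real.one_sub_inv_le_log_of_pos (by norm_num : (0 : ℝ) < 3 / 2)
      rw [show y ^ 2 / (2 / 3 * y ^ 2) = 3 / 2 by field_simp]
      norm_num at this ⊢
      linarith
    have hL : Real.log t / 6 ≤ Real.log (2 / 3 * y ^ 2) := by linarith
    refine le_trans ?_ (mul_log_sub_log_le_setIntegral
      (K := Real.exp (-(3 / 2 * c)) * (Real.log t / 6)) (a := 2 / 3 * y ^ 2) (b := y ^ 2)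
      hf hpos (by linarith) (by linarith) hyt2 fun s hs => ?_)
    · have := mul_le_mul_of_nonneg_left hgap
        (by positivity : 0 ≤ Real.exp (-(3 / 2 * c)) * (Real.log t / 6))
      linarith
    · have hs2 : 2 ≤ s := by linarith [hs.1]
      have hs0 : 0 < s := by linarith
      have hsy : Real.sqrt s ≤ y := Real.sqrt_le_iff.2 ⟨hy.le, hs.2⟩
      have hlog := Real.log_le_log (by positivity) hs.1
      have hs1 : Real.log t / 6 ≤ 1 + y * Real.log s / Real.sqrt s := by
        have hq : 1 ≤ y / Real.sqrt s := (one_le_div (Real.sqrt_pos.2 hs0)).2 hsy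
        have : Real.log s ≤ y / Real.sqrt s * Real.log s :=
          le_mul_of_one_le_left (by linarith) hq
        rw [mul_div_right_comm]
        linarith
      have := hexp s hs2 hs.1
      have hnn : 0 ≤ 1 + y * Real.log s / Real.sqrt s := le_trans (by positivity) hs1
      calc _ = 1 / s * (Real.log t / 6) * Real.exp (-(3 / 2 * c)) := by ring
        _ ≤ _ := by gcongr

theorem log_integral_two_sided (c : ℝ) (hc : 0 < c) :
    ∃ C ≥ (1 : ℝ), ∀ t y : ℝ, 3 ≤ t → 0 < y → y ≤ Real.sqrt t →
      C⁻¹ * Real.log t ≤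
        (∫ s in Set.Icc (2 : ℝ) t,
          (1 / s) * (1 + y * Real.log s / Real.sqrt s) * Real.exp (-c * y ^ 2 / s)) ∧
      (∫ s in Set.Icc (2 : ℝ) t,
          (1 / s) * (1 + y * Real.log s / Real.sqrt s) * Real.exp (-c * y ^ 2 / s)) ≤
        C * Real.log t := by
  have hk : 0 ≤ π / Real.sqrt c := by positivity
  have he : 1 ≤ Real.exp (3 / 2 * c) := Real.one_le_exp (by positivity)
  refine ⟨18 * Real.exp (3 / 2 * c) + π / Real.sqrt c, by linarith, fun t y ht hy hyt => ?_⟩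
  have hl : 0 ≤ Real.log t := Real.log_nonneg (by linarith)
  constructor
  · refine le_trans (mul_le_mul_of_nonneg_right ?_ hl) (le_log_integral hc ht hy hyt)
    calc (18 * Real.exp (3 / 2 * c) + π / Real.sqrt c)⁻¹ ≤ (18 * Real.exp (3 / 2 * c))⁻¹ :=
          inv_anti₀ (by positivity) (by linarith)
      _ = Real.exp (-(3 / 2 * c)) / 18 := by rw [Real.exp_neg, mul_inv]; ring
  · exact (log_integral_le hc ht hy).trans (mul_le_mul_of_nonneg_right (by linarith) hl)
end

section
/- There exist absolute constants c₁, c₂ > 0 such that for all x > 0 and t > 0, c₁ · (1 + x/√t)⁻¹ · e^{−x²/t} ≤ ∫₀^{t/2} x · s^{−3/2} · e^{−x²/(2s)} ds ≤ c₂ · (1 + x/√t)⁻¹ · e^{−x²/t}. -/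
open MeasureTheory Set Real

/-- Fundamental theorem of calculus on `(a, b]` for a nonnegative derivative, given a limit of the
primitive at the left endpoint. -/
lemma integrableOn_and_setIntegral_Ioc_of_hasDerivAt_of_nonneg {f f' : ℝ → ℝ} {a b l : ℝ}
    (hab : a < b) (hderiv : ∀ s ∈ Ioc a b, HasDerivAt f (f' s) s)
    (hnonneg : ∀ s ∈ Ioc a b, 0 ≤ f' s)
    (hl : Filter.Tendsto f (nhdsWithin a (Ioi a)) (nhds l)) :
    IntegrableOn f' (Ioc a b) ∧ ∫ s in Ioc a b, f' s = f b - l := by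
  have hF : ∀ s ∈ Ioo a b, HasDerivAt (Function.update f a l) (f' s) s := by
    intro s hs
    refine (hderiv s ⟨hs.1, hs.2.le⟩).congr_of_eventuallyEq ?_
    filter_upwards [Ioi_mem_nhds hs.1] with y hy
    exact Function.update_of_ne (ne_of_gt hy) _ _
  have hcont : ContinuousOn (Function.update f a l) (Icc a b) := by
    rw [continuousOn_update_iff, Icc_sdiff_left]
    refine ⟨fun s hs => (hderiv s hs).continuousAt.continuousWithinAt, fun _ => ?_⟩
    exact hl.mono_left (nhdsWithin_mono _ fun s hs => hs.1)
  have hint : IntegrableOn f' (Ioc a b) :=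
    intervalIntegral.integrableOn_deriv_of_nonneg hcont hF
      fun s hs => hnonneg s ⟨hs.1, hs.2.le⟩
  refine ⟨hint, ?_⟩
  rw [← intervalIntegral.integral_of_le hab.le,
    intervalIntegral.integral_eq_sub_of_hasDerivAt_of_le hab.le hcont hF
      ((intervalIntegrable_iff_integrableOn_Ioc_of_le hab.le).2 hint),
    Function.update_of_ne hab.ne', Function.update_self]

/-- The elementary function comparable to the upper Gaussian tail. -/
noncomputable def millsBound (u : ℝ) : ℝ := (1 + u)⁻¹ * exp (-u ^ 2 / 2)

lemma hasDerivAt_millsBound {u : ℝ} (hu : 0 ≤ u) :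
    HasDerivAt millsBound (-((u ^ 2 + u + 1) / (1 + u) ^ 2 * exp (-u ^ 2 / 2))) u := by
  have h1 : (1 + u) ≠ 0 := by positivity
  have h2 : HasDerivAt (fun v : ℝ => (1 + v)⁻¹) (-1 / (1 + u) ^ 2) u :=
    ((hasDerivAt_id u).const_add 1).fun_inv h1
  have h3 : HasDerivAt (fun v : ℝ => exp (-v ^ 2 / 2)) (exp (-u ^ 2 / 2) * (-u)) u := by
    have h4 : HasDerivAt (fun v : ℝ => -v ^ 2 / 2) (-u) u := by
      refine (((hasDerivAt_pow 2 u).neg).div_const 2).congr_deriv ?_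
      norm_num
      ring
    exact h4.exp
  refine (h2.mul h3).congr_deriv ?_
  field_simp
  ring

lemma tendsto_millsBound_atTop : Filter.Tendsto millsBound Filter.atTop (nhds 0) := by
  have h : Filter.Tendsto (fun u : ℝ => (1 + u)⁻¹) Filter.atTop (nhds 0) :=
    (Filter.tendsto_atTop_add_const_left _ 1 Filter.tendsto_id).inv_tendsto_atTop
  refine tendsto_of_tendsto_of_tendsto_of_le_of_le' tendsto_const_nhds h ?_ ?_
  · filter_upwards [Filter.eventually_ge_atTop 0] with u hu
    unfold millsBound
    positivity
  · filter_upwards [Filter.eventually_ge_atTop 0] with u hu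
    refine mul_le_of_le_one_right (by positivity) (exp_le_one_iff.2 ?_)
    nlinarith [sq_nonneg u]

lemma mul_rpow_neg_half_sq (x : ℝ) {s : ℝ} (hs : 0 < s) :
    (x * s ^ (-(1 : ℝ) / 2)) ^ 2 = x ^ 2 / s := by
  rw [mul_pow, ← rpow_natCast (s ^ _), ← rpow_mul hs.le]
  norm_num [rpow_neg_one, div_eq_mul_inv]

/-- The first passage integral up to time `T` lies between two multiples of
`millsBound (x / √T)`. -/
lemma first_passage_integral_bounds {x T : ℝ} (hx : 0 < x) (hT : 0 < T) :
    2 * millsBound (x * T ^ (-(1 : ℝ) / 2)) ≤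
        ∫ s in Ioc 0 T, x * s ^ (-(3 : ℝ) / 2) * exp (-x ^ 2 / (2 * s)) ∧
      ∫ s in Ioc 0 T, x * s ^ (-(3 : ℝ) / 2) * exp (-x ^ 2 / (2 * s)) ≤
        8 / 3 * millsBound (x * T ^ (-(1 : ℝ) / 2)) := by
  set g : ℝ → ℝ := fun s => x * s ^ (-(3 : ℝ) / 2) * exp (-x ^ 2 / (2 * s)) with hg
  set u : ℝ → ℝ := fun s => x * s ^ (-(1 : ℝ) / 2) with hu
  set r : ℝ → ℝ := fun s => (u s ^ 2 + u s + 1) / (1 + u s) ^ 2 with hr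
  have hu0 : ∀ s ∈ Ioc 0 T, 0 ≤ u s := fun s hs =>
    mul_nonneg hx.le (rpow_nonneg hs.1.le _)
  have hg0 : ∀ s ∈ Ioc 0 T, 0 ≤ g s := fun s hs =>
    mul_nonneg (mul_nonneg hx.le (rpow_nonneg hs.1.le _)) (exp_pos _).le
  have hr1 : ∀ s ∈ Ioc 0 T, r s ≤ 1 := by
    intro s hs
    have := hu0 s hs
    rw [hr, div_le_one (by positivity)]
    nlinarith
  have hr2 : ∀ s ∈ Ioc 0 T, 3 / 4 ≤ r s := by
    intro s hs
    have := hu0 s hs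
    rw [hr, le_div_iff₀ (by positivity)]
    nlinarith [sq_nonneg (u s - 1)]
  have hderiv : ∀ s ∈ Ioc 0 T, HasDerivAt (fun s => millsBound (u s)) (r s * g s / 2) s := by
    intro s hs
    have h1 : HasDerivAt u (x * (-(1 : ℝ) / 2 * s ^ (-(1 : ℝ) / 2 - 1))) s :=
      (hasDerivAt_rpow_const (Or.inl hs.1.ne')).const_mul x
    refine ((hasDerivAt_millsBound (hu0 s hs)).comp s h1).congr_deriv ?_
    have h2 : -u s ^ 2 / 2 = -x ^ 2 / (2 * s) := by
      rw [hu, mul_rpow_neg_half_sq x hs.1]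
      field_simp
    have h3 : -(1 : ℝ) / 2 - 1 = -3 / 2 := by norm_num
    rw [h2, h3]
    simp only [hr, hg]
    ring
  have hlim : Filter.Tendsto (fun s => millsBound (u s)) (nhdsWithin 0 (Ioi 0)) (nhds 0) :=
    tendsto_millsBound_atTop.comp
      ((tendsto_rpow_neg_nhdsGT_zero (by norm_num)).const_mul_atTop hx)
  obtain ⟨hint, heq⟩ := integrableOn_and_setIntegral_Ioc_of_hasDerivAt_of_nonneg hT hderiv
    (fun s hs => by nlinarith [mul_nonneg (sub_nonneg.2 (hr2 s hs)) (hg0 s hs), hg0 s hs]) hlim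
  rw [sub_zero] at heq
  have hle : ∀ s ∈ Ioc 0 T, g s ≤ 8 / 3 * (r s * g s / 2) := fun s hs => by
    nlinarith [mul_nonneg (sub_nonneg.2 (hr2 s hs)) (hg0 s hs)]
  have hgint : IntegrableOn g (Ioc 0 T) := by
    refine (hint.const_mul (8 / 3)).mono' ?_ ?_
    · have : Measurable g := by fun_prop
      exact this.aestronglyMeasurable
    · filter_upwards [ae_restrict_mem measurableSet_Ioc] with s hs
      rw [norm_of_nonneg (hg0 s hs)]
      exact hle s hs
  rw [← heq, ← integral_const_mul, ← integral_const_mul]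
  constructor
  · refine setIntegral_mono_on (hint.const_mul 2) hgint measurableSet_Ioc fun s hs => ?_
    change 2 * (r s * g s / 2) ≤ g s
    nlinarith [mul_nonneg (sub_nonneg.2 (hr1 s hs)) (hg0 s hs)]
  · exact setIntegral_mono_on hgint (hint.const_mul (8 / 3)) measurableSet_Ioc hle

theorem first_passage_integral_two_sided :
    ∃ c₁ > (0 : ℝ), ∃ c₂ > (0 : ℝ), ∀ x t : ℝ, 0 < x → 0 < t →
      c₁ * (1 + x / Real.sqrt t)⁻¹ * Real.exp (-x ^ 2 / t) ≤
        (∫ s in Set.Ioc 0 (t / 2), x * s ^ (-(3 : ℝ) / 2) * Real.exp (-x ^ 2 / (2 * s))) ∧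
      (∫ s in Set.Ioc 0 (t / 2), x * s ^ (-(3 : ℝ) / 2) * Real.exp (-x ^ 2 / (2 * s))) ≤
        c₂ * (1 + x / Real.sqrt t)⁻¹ * Real.exp (-x ^ 2 / t) := by
  refine ⟨1, one_pos, 8 / 3, by norm_num, fun x t hx ht => ?_⟩
  obtain ⟨hlow, hupp⟩ := first_passage_integral_bounds hx (half_pos ht)
  set a := x * (t / 2) ^ (-(1 : ℝ) / 2) with ha
  have ha0 : 0 ≤ a := by positivity
  have hasq : a ^ 2 = x ^ 2 / (t / 2) := mul_rpow_neg_half_sq x (half_pos ht)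
  have hexp : -a ^ 2 / 2 = -x ^ 2 / t := by
    rw [hasq]
    field_simp
  set y := x / √t with hy
  have hy0 : 0 ≤ y := by positivity
  have hya : a ^ 2 = 2 * y ^ 2 := by
    rw [hasq, hy, div_pow, sq_sqrt ht.le]
    field_simp
  have hle : y ≤ a := abs_le_of_sq_le_sq' (by nlinarith) ha0 |>.2
  have hge : a ≤ 2 * y := abs_le_of_sq_le_sq' (by nlinarith) (by positivity) |>.2
  rw [millsBound, hexp, ← mul_assoc] at hlow hupp
  refine ⟨le_trans ?_ hlow, hupp.trans ?_⟩
  · refine mul_le_mul_of_nonneg_right ?_ (exp_pos _).le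
    rw [← div_eq_mul_inv, ← div_eq_mul_inv, div_le_div_iff₀ (by positivity) (by positivity)]
    linarith
  · gcongr
end

section
/- For every a > 0 there exist constants C₁, C₂ > 0 such that for every λ > 0, C₁ · log(1 + 1/λ) · e^{−3aλ²} ≤ ∫_λ^∞ r⁻¹ · e^{−a r²} dr ≤ C₂ · log(1 + 1/λ) · e^{−aλ²}. -/
open MeasureTheory Set Real

lemma hasDerivAt_log_one_add_one_div_mul_exp (b : ℝ) {r : ℝ} (hr : 0 < r) :
    HasDerivAt (fun r : ℝ => Real.log (1 + 1 / r) * Real.exp (-b * r ^ 2))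
      (-((1 / (r * (r + 1)) + 2 * b * r * Real.log (1 + 1 / r)) * Real.exp (-b * r ^ 2))) r := by
  have hpos : 0 < 1 + 1 / r := by positivity
  have h1 : HasDerivAt (fun r : ℝ => 1 + 1 / r) (-(r ^ 2)⁻¹) r := by
    simpa [one_div] using (hasDerivAt_inv hr.ne').const_add 1
  have h2 : HasDerivAt (fun r : ℝ => -b * r ^ 2) (-b * (2 * r)) r := by
    simpa using (hasDerivAt_pow 2 r).const_mul (-b)
  refine ((h1.log hpos.ne').mul h2.exp).congr_deriv ?_
  have h3 : -(r ^ 2)⁻¹ / (1 + 1 / r) = -(1 / (r * (r + 1))) := by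
    have : r + 1 ≠ 0 := by positivity
    field_simp
  rw [h3]
  ring

lemma log_one_add_one_div_nonneg {r : ℝ} (hr : 0 < r) : 0 ≤ Real.log (1 + 1 / r) :=
  Real.log_nonneg (by linarith [one_div_pos.mpr hr])

lemma log_one_add_one_div_le {r : ℝ} (hr : 0 < r) : Real.log (1 + 1 / r) ≤ 1 / r := by
  linarith [Real.log_le_sub_one_of_pos (show 0 < 1 + 1 / r by positivity)]

lemma one_div_add_one_le_log_one_add_one_div {r : ℝ} (hr : 0 < r) :
    1 / (r + 1) ≤ Real.log (1 + 1 / r) := by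
  have h := Real.one_sub_inv_le_log_of_pos (show 0 < 1 + 1 / r by positivity)
  have h' : 1 - (1 + 1 / r)⁻¹ = 1 / (r + 1) := by
    field_simp
    ring
  rwa [h'] at h

lemma tendsto_log_one_add_one_div_mul_exp {b : ℝ} (hb : 0 < b) :
    Filter.Tendsto (fun r : ℝ => Real.log (1 + 1 / r) * Real.exp (-b * r ^ 2))
      Filter.atTop (nhds 0) := by
  have h : Filter.Tendsto (fun r : ℝ => 1 / r) Filter.atTop (nhds 0) := by
    simpa [one_div] using tendsto_inv_atTop_zero (𝕜 := ℝ)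
  refine squeeze_zero' ?_ ?_ h
  · filter_upwards [Filter.eventually_gt_atTop 0] with r hr
    exact mul_nonneg (log_one_add_one_div_nonneg hr) (Real.exp_pos _).le
  · filter_upwards [Filter.eventually_gt_atTop 0] with r hr
    have h1 : Real.exp (-b * r ^ 2) ≤ 1 :=
      Real.exp_le_one_iff.mpr (by nlinarith [mul_nonneg hb.le (sq_nonneg r)])
    exact (mul_le_of_le_one_right (log_one_add_one_div_nonneg hr) h1).trans
      (log_one_add_one_div_le hr)

lemma integrableOn_and_integral_log_one_add_one_div_mul_exp {b l : ℝ} (hb : 0 < b) (hl : 0 < l) :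
    IntegrableOn (fun r : ℝ => (1 / (r * (r + 1)) + 2 * b * r * Real.log (1 + 1 / r)) *
      Real.exp (-b * r ^ 2)) (Ioi l) ∧
    ∫ r in Ioi l, (1 / (r * (r + 1)) + 2 * b * r * Real.log (1 + 1 / r)) *
      Real.exp (-b * r ^ 2) = Real.log (1 + 1 / l) * Real.exp (-b * l ^ 2) := by
  have hd : ∀ r ∈ Ici l, HasDerivAt (fun r : ℝ => Real.log (1 + 1 / r) * Real.exp (-b * r ^ 2))
      (-((1 / (r * (r + 1)) + 2 * b * r * Real.log (1 + 1 / r)) * Real.exp (-b * r ^ 2))) r :=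
    fun r hr => hasDerivAt_log_one_add_one_div_mul_exp b (hl.trans_le hr)
  have hn : ∀ r ∈ Ioi l,
      -((1 / (r * (r + 1)) + 2 * b * r * Real.log (1 + 1 / r)) * Real.exp (-b * r ^ 2)) ≤ 0 := by
    intro r hr
    have hr0 : 0 < r := hl.trans hr
    have := log_one_add_one_div_nonneg hr0
    exact neg_nonpos.mpr (by positivity)
  have ht := tendsto_log_one_add_one_div_mul_exp hb
  constructor
  · simpa using (integrableOn_Ioi_deriv_of_nonpos' hd hn ht).neg
  · have h := integral_Ioi_of_hasDerivAt_of_nonpos' hd hn ht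
    rw [integral_neg] at h
    linarith

lemma inv_mul_exp_le {a r : ℝ} (ha : 0 < a) (hr : 0 < r) :
    r⁻¹ * Real.exp (-a * r ^ 2) ≤ (1 + 1 / (8 * a)) *
      ((1 / (r * (r + 1)) + 2 * a * r * Real.log (1 + 1 / r)) * Real.exp (-a * r ^ 2)) := by
  rw [← mul_assoc]
  refine mul_le_mul_of_nonneg_right ?_ (Real.exp_pos _).le
  have hq : r + 1 ≤ (1 + 1 / (8 * a)) * (1 + 2 * a * r ^ 2) := by
    have h : (1 + 1 / (8 * a)) * (1 + 2 * a * r ^ 2) - (r + 1) =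
        (4 * a * r - 1) ^ 2 / (8 * a) + r ^ 2 / 4 := by
      field_simp
      ring
    have : 0 ≤ (4 * a * r - 1) ^ 2 / (8 * a) + r ^ 2 / 4 := by positivity
    linarith
  calc r⁻¹ = (r + 1) * (1 / (r * (r + 1))) := by field_simp
    _ ≤ ((1 + 1 / (8 * a)) * (1 + 2 * a * r ^ 2)) * (1 / (r * (r + 1))) := by gcongr
    _ = (1 + 1 / (8 * a)) * (1 / (r * (r + 1)) + 2 * a * r * (1 / (r + 1))) := by field_simp
    _ ≤ _ := by
      gcongr
      exact one_div_add_one_le_log_one_add_one_div hr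

lemma le_inv_mul_exp {a r : ℝ} (ha : 0 < a) (hr : 0 < r) :
    (1 + 9 * a / 2)⁻¹ * ((1 / (r * (r + 1)) + 2 * (3 * a) * r * Real.log (1 + 1 / r)) *
      Real.exp (-(3 * a) * r ^ 2)) ≤ r⁻¹ * Real.exp (-a * r ^ 2) := by
  have hexp : Real.exp (-a * r ^ 2) =
      Real.exp (2 * a * r ^ 2) * Real.exp (-(3 * a) * r ^ 2) := by
    rw [← Real.exp_add]
    ring_nf
  rw [hexp, ← mul_assoc (1 + 9 * a / 2)⁻¹, ← mul_assoc r⁻¹]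
  refine mul_le_mul_of_nonneg_right ?_ (Real.exp_pos _).le
  rw [inv_mul_le_iff₀ (by positivity)]
  have h1 : 1 / (r * (r + 1)) ≤ r⁻¹ := by
    rw [← one_div]
    exact one_div_le_one_div_of_le hr (by nlinarith)
  have h2 : 2 * (3 * a) * r * Real.log (1 + 1 / r) ≤ 2 * (3 * a) * r * (1 / r) := by
    gcongr
    exact log_one_add_one_div_le hr
  have hq : 1 + 6 * a * r ≤ (1 + 9 * a / 2) * (2 * a * r ^ 2 + 1) := by
    nlinarith [mul_nonneg ha.le (sq_nonneg (2 * r - 3)), sq_nonneg (a * r)]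
  calc _ ≤ r⁻¹ + 2 * (3 * a) * r * (1 / r) := add_le_add h1 h2
    _ = r⁻¹ * (1 + 6 * a * r) := by
      field_simp
      ring
    _ ≤ r⁻¹ * ((1 + 9 * a / 2) * Real.exp (2 * a * r ^ 2)) := by
      gcongr
      exact hq.trans (by gcongr; exact Real.add_one_le_exp _)
    _ = _ := by ring

theorem log_tail_integral_two_sided (a : ℝ) (ha : 0 < a) :
    ∃ C₁ > (0 : ℝ), ∃ C₂ > (0 : ℝ), ∀ l : ℝ, 0 < l →
      C₁ * Real.log (1 + 1 / l) * Real.exp (-3 * a * l ^ 2) ≤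
        (∫ r in Set.Ici l, r⁻¹ * Real.exp (-a * r ^ 2)) ∧
      (∫ r in Set.Ici l, r⁻¹ * Real.exp (-a * r ^ 2)) ≤
        C₂ * Real.log (1 + 1 / l) * Real.exp (-a * l ^ 2) := by
  refine ⟨(1 + 9 * a / 2)⁻¹, by positivity, 1 + 1 / (8 * a), by positivity, fun l hl => ?_⟩
  obtain ⟨hi₁, he₁⟩ :=
    integrableOn_and_integral_log_one_add_one_div_mul_exp (b := 3 * a) (by positivity) hl
  obtain ⟨hi₂, he₂⟩ := integrableOn_and_integral_log_one_add_one_div_mul_exp ha hl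
  have hi : IntegrableOn (fun r : ℝ => r⁻¹ * Real.exp (-a * r ^ 2)) (Ioi l) := by
    refine Integrable.mono' (hi₂.const_mul (1 + 1 / (8 * a)))
      (by fun_prop : Measurable _).aestronglyMeasurable ?_
    filter_upwards [ae_restrict_mem measurableSet_Ioi] with r hr
    have hr0 : 0 < r := hl.trans hr
    rw [Real.norm_of_nonneg (by positivity)]
    exact inv_mul_exp_le ha hr0
  rw [integral_Ici_eq_integral_Ioi, neg_mul 3 a, mul_assoc (1 + 9 * a / 2)⁻¹,
    mul_assoc (1 + 1 / (8 * a)), ← he₁, ← he₂,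
    ← integral_const_mul, ← integral_const_mul]
  exact ⟨setIntegral_mono_on (hi₁.const_mul _) hi measurableSet_Ioi
      fun r hr => le_inv_mul_exp ha (hl.trans hr),
    setIntegral_mono_on hi (hi₂.const_mul _) measurableSet_Ioi
      fun r hr => inv_mul_exp_le ha (hl.trans hr)⟩
end

section
/- There exist constants c₁, c₂, c₃, c₄ > 0 such that for all t > 0 and all x, y ≥ 0, c₁ · t^{−1/2} · min(1, x/√t) · min(1, y/√t) · e^{−c₂ (x−y)²/t} ≤ (2πt)^{−1/2} · e^{−(x−y)²/(2t)} · (1 − e^{−2xy/t}) ≤ c₃ · t^{−1/2} · min(1, x/√t) · min(1, y/√t) · e^{−c₄ (x−y)²/t}. -/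
open MeasureTheory Set Real

/-- In rescaled variables, `1 - exp (-2ab)` dominates the product of the boundary factors. -/
lemma min_one_mul_min_one_le_one_sub_exp {a b : ℝ} (ha : 0 ≤ a) (hb : 0 ≤ b) :
    2 / 3 * (min 1 a * min 1 b) ≤ 1 - Real.exp (-(2 * (a * b))) := by
  have ha' : 0 ≤ min 1 a := le_min zero_le_one ha
  have hb' : 0 ≤ min 1 b := le_min zero_le_one hb
  have h_one : min 1 a * min 1 b ≤ 1 := mul_le_one₀ (min_le_left _ _) hb' (min_le_left _ _)
  have h_mul : min 1 a * min 1 b ≤ a * b :=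
    mul_le_mul (min_le_right _ _) (min_le_right _ _) hb' ha
  have h_nonneg : 0 ≤ min 1 a * min 1 b := mul_nonneg ha' hb'
  generalize min 1 a * min 1 b = p at *
  have h_mono : Real.exp (-(2 * (a * b))) ≤ Real.exp (-(2 * p)) :=
    Real.exp_le_exp.2 (by linarith)
  have h_inv : Real.exp (-(2 * p)) * Real.exp (2 * p) = 1 := by
    rw [← Real.exp_add]; simp
  have h_exp := Real.add_one_le_exp (2 * p)
  have h_pos := Real.exp_pos (-(2 * p))
  have h_mul_le : Real.exp (-(2 * p)) * (2 * p + 1) ≤ 1 :=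
    (mul_le_mul_of_nonneg_left h_exp h_pos.le).trans_eq h_inv
  nlinarith

/-- In rescaled variables, `1 - exp (-2ab)` is dominated by the product of the boundary factors,
up to a Gaussian growth in `a - b`. -/
lemma one_sub_exp_le_min_one_mul_min_one {a b : ℝ} (ha : 0 ≤ a) (hb : 0 ≤ b) :
    1 - Real.exp (-(2 * (a * b))) ≤
      4 * (min 1 a * min 1 b) * Real.exp ((a - b) ^ 2 / 4) := by
  have h_exp := Real.add_one_le_exp ((a - b) ^ 2 / 4)
  have h_one : 1 - Real.exp (-(2 * (a * b))) ≤ 1 := by linarith [Real.exp_pos (-(2 * (a * b)))]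
  have h_lin : 1 - Real.exp (-(2 * (a * b))) ≤ 2 * (a * b) := by
    linarith [Real.add_one_le_exp (-(2 * (a * b)))]
  refine le_trans ?_ (mul_le_mul_of_nonneg_left h_exp
    (by have := le_min zero_le_one ha; have := le_min zero_le_one hb; positivity))
  rcases le_total 1 a with h1 | h1 <;> rcases le_total 1 b with h2 | h2 <;>
    simp only [min_eq_left, min_eq_right, h1, h2]
  · nlinarith [sq_nonneg (a - b)]
  · have : a ≤ 2 * ((a - b) ^ 2 / 4 + 1) := by nlinarith [sq_nonneg (a - b - 1)]
    nlinarith [mul_le_mul_of_nonneg_left this hb]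
  · have : b ≤ 2 * ((a - b) ^ 2 / 4 + 1) := by nlinarith [sq_nonneg (b - a - 1)]
    nlinarith [mul_le_mul_of_nonneg_left this ha]
  · nlinarith [mul_nonneg ha hb, mul_nonneg (mul_nonneg ha hb) (sq_nonneg (a - b))]

theorem dirichlet_halfline_kernel_two_sided :
    ∃ c₁ > (0 : ℝ), ∃ c₂ > (0 : ℝ), ∃ c₃ > (0 : ℝ), ∃ c₄ > (0 : ℝ),
      ∀ t x y : ℝ, 0 < t → 0 ≤ x → 0 ≤ y →
        c₁ * t ^ (-(1 : ℝ) / 2) * min 1 (x / Real.sqrt t) * min 1 (y / Real.sqrt t) *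
            Real.exp (-c₂ * (x - y) ^ 2 / t) ≤
          (2 * Real.pi * t) ^ (-(1 : ℝ) / 2) * Real.exp (-(x - y) ^ 2 / (2 * t)) *
            (1 - Real.exp (-2 * x * y / t)) ∧
        (2 * Real.pi * t) ^ (-(1 : ℝ) / 2) * Real.exp (-(x - y) ^ 2 / (2 * t)) *
            (1 - Real.exp (-2 * x * y / t)) ≤
          c₃ * t ^ (-(1 : ℝ) / 2) * min 1 (x / Real.sqrt t) * min 1 (y / Real.sqrt t) *
            Real.exp (-c₄ * (x - y) ^ 2 / t) := by
  have hK : 0 < (2 * Real.pi) ^ (-(1 : ℝ) / 2) := by positivity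
  refine ⟨(2 * Real.pi) ^ (-(1 : ℝ) / 2) * (2 / 3), by positivity, 1 / 2, by norm_num,
    (2 * Real.pi) ^ (-(1 : ℝ) / 2) * 4, by positivity, 1 / 4, by norm_num, ?_⟩
  intro t x y ht hx hy
  have hs : 0 < √t := Real.sqrt_pos.2 ht
  obtain ⟨a, rfl⟩ : ∃ a, x = a * √t := ⟨x / √t, by field_simp⟩
  obtain ⟨b, rfl⟩ : ∃ b, y = b * √t := ⟨y / √t, by field_simp⟩
  have ha : 0 ≤ a := nonneg_of_mul_nonneg_left hx hs
  have hb : 0 ≤ b := nonneg_of_mul_nonneg_left hy hs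
  have hsq : √t ^ 2 = t := Real.sq_sqrt ht.le
  have h_diff : (a * √t - b * √t) ^ 2 = (a - b) ^ 2 * t := by
    rw [← sub_mul, mul_pow, hsq]
  have h_prod : -2 * (a * √t) * (b * √t) / t = -(2 * (a * b)) := by
    rw [div_eq_iff ht.ne']; linear_combination (-2 * a * b) * hsq
  have h_half : -((a - b) ^ 2 * t) / (2 * t) = -((a - b) ^ 2 / 2) := by field_simp
  have h_scale (c : ℝ) : -c * ((a - b) ^ 2 * t) / t = -(c * (a - b) ^ 2) := by field_simp
  have h_split : Real.exp (-(1 / 4 * (a - b) ^ 2)) =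
      Real.exp (-((a - b) ^ 2 / 2)) * Real.exp ((a - b) ^ 2 / 4) := by
    rw [← Real.exp_add]; ring_nf
  rw [h_diff, h_prod, h_half, h_scale, h_scale, mul_div_cancel_right₀ _ hs.ne',
    mul_div_cancel_right₀ _ hs.ne', Real.mul_rpow (by positivity) ht.le, h_split,
    show 1 / 2 * (a - b) ^ 2 = (a - b) ^ 2 / 2 by ring]
  have hP : 0 ≤ (2 * Real.pi) ^ (-(1 : ℝ) / 2) * t ^ (-(1 : ℝ) / 2) *
      Real.exp (-((a - b) ^ 2 / 2)) := by positivity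
  constructor
  · linear_combination mul_le_mul_of_nonneg_left (min_one_mul_min_one_le_one_sub_exp ha hb) hP
  · linear_combination mul_le_mul_of_nonneg_left (one_sub_exp_le_min_one_mul_min_one ha hb) hP
end
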